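/- In the Weyl group $W_n$ of type $B_n/C_n$ with $n = 2c$ even, the $j$-induction of the sign representation from the naturally embedded reflection subgroup $W_c \times W'_c$ equals the $j$-induction of the sign representation from the reflection subgroup $S_n$, and both equal the irreducible representation with bipartition symbol $[(0<2<3<4<\dots<c+1),(1<2<3<\dots<c)]$. -/

import Mathlib

open Finset Equiv

namespace CS

noncomputable section

/-- Inner product of class functions on a finite group. -/
def cinner {G : Type} [Group G] (φ ψ : G → ℂ) : ℂ :=
  (Nat.card G : ℂ)⁻¹ * ∑ᶠ g : G, φ g * ψ g⁻¹

/-- The character of the `d`-th symmetric power of a representation with character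
`χ`, computed via Newton's recursion
`d·χ_{Sym^d}(g) = ∑_{k=1}^{d} χ(g^k) χ_{Sym^{d-k}}(g)`. -/
def symChar {G : Type} [Group G] (χ : G → ℂ) : ℕ → G → ℂ
  | 0, _ => 1
  | (d+1), g => ((d : ℂ) + 1)⁻¹ *
      ∑ k ∈ Finset.range (d + 1), χ (g ^ (k + 1)) * symChar χ (d - k) g
  termination_by d _ => d
  decreasing_by omega

/-- Induction of class functions from a subgroup `H` to a subgroup `K` (of an ambient
group `G`), by the usual induced-character formula. -/
def indChar {G : Type} [Group G] (H K : Subgroup G) (φ : H → ℂ) : K → ℂ :=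
  open scoped Classical in
  fun g => (Nat.card H : ℂ)⁻¹ *
    ∑ᶠ x : K, if h : ((x : G) * g * (x : G)⁻¹) ∈ H then φ ⟨_, h⟩ else 0

/-- Restriction of a class function on the ambient group to a subgroup. -/
def resChar {G : Type} [Group G] (H : Subgroup G) (χ : G → ℂ) : H → ℂ :=
  fun h => χ h

/-- Restriction of a class function from a subgroup `K` to a subgroup `H` (junk value
`0` off `K`; meaningful when `H ≤ K`). -/
def resSub {G : Type} [Group G] (H K : Subgroup G) (χ : K → ℂ) : H → ℂ :=
  open scoped Classical in
  fun h => if hh : (h : G) ∈ K then χ ⟨_, hh⟩ else 0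

/-- `χ` is the character of a (finite-dimensional, complex) representation. -/
def IsChar {G : Type} [Group G] (χ : G → ℂ) : Prop :=
  ∃ (V : Type) (_ : AddCommGroup V) (_ : Module ℂ V) (ρ : Representation ℂ G V),
    FiniteDimensional ℂ V ∧ ∀ g, χ g = LinearMap.trace ℂ V (ρ g)

/-- `χ` is an irreducible character: a genuine character of norm one. -/
def IsIrrChar {G : Type} [Group G] (χ : G → ℂ) : Prop :=
  IsChar χ ∧ cinner χ χ = 1

/-- Multiplicity of `χE` in the `d`-th symmetric power of the reflection
representation (with character `χR`). -/
def bMult {G : Type} [Group G] (χR χE : G → ℂ) (d : ℕ) : ℂ :=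
  cinner χE (symChar χR d)

/-- `b` is the `b`-invariant of `χE`: the least degree of the symmetric algebra of
the reflection representation containing `χE`. -/
def IsBAt {G : Type} [Group G] (χR χE : G → ℂ) (b : ℕ) : Prop :=
  bMult χR χE b ≠ 0 ∧ ∀ d < b, bMult χR χE d = 0

/-- `χE = j_H^K (χE')` (GP 5.2.6): `χE` is an irreducible character of `K` occurring
in the induction of `χE'` from `H`, with the same `b`-invariant as `χE'`, where `χE'`
occurs with multiplicity one in the corresponding symmetric power for `H`; the
reflection characters of `H` and `K` are the restrictions of the ambient reflection
character `χR`. -/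
def IsJInd {G : Type} [Group G] (χR : G → ℂ) (H K : Subgroup G)
    (χE' : H → ℂ) (χE : K → ℂ) : Prop :=
  IsIrrChar χE ∧ cinner χE (indChar H K χE') ≠ 0 ∧
  ∃ b, IsBAt (resChar H χR) χE' b ∧ bMult (resChar H χR) χE' b = 1 ∧
    IsBAt (resChar K χR) χE b

/-! ### The hyperoctahedral group and its reflection subgroups.

We realize `W_n` (type `B_n/C_n`) as the permutations of `Fin n ⊕ Fin n`
(thought of as `{1,…,n} ⊔ {-1,…,-n}`) generated by the reflections below; `W'_n`
(type `D_n`) and the various reflection subgroups are likewise generated by the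
appropriate reflections. -/

/-- Ambient permutation group of the `2n` points. -/
abbrev PG (n : ℕ) := Equiv.Perm (Fin n ⊕ Fin n)

/-- The reflection-representation matrix of a signed permutation. -/
def Mrefl {n : ℕ} (π : PG n) : Matrix (Fin n) (Fin n) ℂ :=
  Matrix.of fun j i =>
    (if π (Sum.inl i) = Sum.inl j then 1 else 0) -
      (if π (Sum.inl i) = Sum.inr j then 1 else 0)

/-- The character of the reflection representation (on signed permutations). -/
def reflChar {n : ℕ} : PG n → ℂ := fun π => (Mrefl π).trace

/-- The sign (determinant) character of the reflection representation. -/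
def sgnChar {n : ℕ} : PG n → ℂ := fun π => (Mrefl π).det

/-- The reflection `(e_i ↔ e_j)` (a double transposition). -/
def dsw {n : ℕ} (i j : Fin n) : PG n :=
  Equiv.swap (Sum.inl i) (Sum.inl j) * Equiv.swap (Sum.inr i) (Sum.inr j)

/-- The reflection `e_i ↦ -e_i` (a sign change). -/
def ssw {n : ℕ} (i : Fin n) : PG n := Equiv.swap (Sum.inl i) (Sum.inr i)

/-- The reflection `e_i ↦ -e_j, e_j ↦ -e_i`. -/
def msw {n : ℕ} (i j : Fin n) : PG n :=
  Equiv.swap (Sum.inl i) (Sum.inr j) * Equiv.swap (Sum.inr i) (Sum.inl j)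

/-- Types of blocks: symmetric group (`A`-type), hyperoctahedral (`B`-type),
even-signed (`D`-type). -/
inductive BTy | S | B | D
deriving DecidableEq

/-- The reflection subgroup of `W_n` determined by a block structure: `f` assigns to
each index its block, `ty` the type of each index.  On an `S`-block only the
transpositions `dsw` act, on a `B`-block also the sign changes, on a `D`-block the
`dsw` and the `msw`.  (`W_{m₁} × … `-style products of reflection subgroups.) -/
def blkSub (n : ℕ) (f : Fin n → ℕ) (ty : Fin n → BTy) : Subgroup (PG n) :=
  Subgroup.closure
    ({π | ∃ i j, f i = f j ∧ π = dsw i j} ∪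
     {π | ∃ i, ty i = BTy.B ∧ π = ssw i} ∪
     {π | ∃ i j, f i = f j ∧ ty i = BTy.D ∧ ty j = BTy.D ∧ π = msw i j})

/-- The hyperoctahedral group `W_n` (Weyl group of type `B_n/C_n`). -/
def BWn (n : ℕ) : Subgroup (PG n) := blkSub n (fun _ => 0) (fun _ => BTy.B)

/-- The Weyl group `W'_n` of type `D_n` (the even elements of `W_n`). -/
def DWn (n : ℕ) : Subgroup (PG n) := blkSub n (fun _ => 0) (fun _ => BTy.D)

/-- The block of the index `i`, for blocks of consecutive sizes `c 0, c 1, …`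
(`N` blocks in total). -/
def blockOf (N : ℕ) (c : ℕ → ℕ) (i : ℕ) : ℕ :=
  ((Finset.range N).filter fun b => ∑ b' ∈ Finset.range (b + 1), c b' ≤ i).card

/-- The linear character of (a reflection subgroup of) `W_n` given by the product of
the signs of the coordinates in `T`. -/
def epsOn {n : ℕ} (T : Set (Fin n)) : PG n → ℂ :=
  open scoped Classical in
  fun π => ∏ᶠ i : Fin n, if i ∈ T ∧ (∃ j, π (Sum.inl i) = Sum.inr j) then -1 else 1

/-- The basic induced character of `W_n` attached to two sequences of (possibly
negative, in which case the character is `0`) block sizes: the character induced from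
the product of the hyperoctahedral groups of the blocks, of the (trivial) ⊠ (product
of signs of coordinates) character, the second family of blocks carrying the
sign-of-coordinates character.  (These are the `h`-pieces of the Jacobi–Trudi-type
formula for the irreducible characters of `W_n`.) -/
def indPiece (n r s : ℕ) (c : Fin r → ℤ) (d : Fin s → ℤ) : (BWn n) → ℂ :=
  open scoped Classical in
  if (∀ i, 0 ≤ c i) ∧ (∀ j, 0 ≤ d j) ∧ ((∑ i, c i) + ∑ j, d j) = (n : ℤ) then
    letI cs : ℕ → ℕ := fun b =>
      if hb : b < r then (c ⟨b, hb⟩).toNat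
      else if hb' : b - r < s then (d ⟨b - r, hb'⟩).toNat else 0
    letI f : Fin n → ℕ := fun i => blockOf (r + s) cs (i : ℕ)
    indChar (blkSub n f (fun _ => BTy.B)) (BWn n)
      (resChar _ (epsOn {i | r ≤ f i}))
  else 0

/-- The irreducible character of the hyperoctahedral group `W_n` attached to a
bipartition `(α, β)` (each written as a weakly decreasing integer vector), via the
Jacobi–Trudi-type determinantal formula
`χ_{(α,β)} = ∑_{σ,τ} sgn(σ)sgn(τ) · indPiece((αᵢ - i + σ(i))ᵢ, (βⱼ - j + τ(j))ⱼ)`. -/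
def chiB (n r s : ℕ) (α : Fin r → ℤ) (β : Fin s → ℤ) : (BWn n) → ℂ :=
  fun w => ∑ᶠ σ : Equiv.Perm (Fin r), ∑ᶠ τ : Equiv.Perm (Fin s),
    (((Equiv.Perm.sign σ : ℤ) * (Equiv.Perm.sign τ : ℤ) : ℤ) : ℂ) *
      indPiece n r s (fun i => α i - (i : ℕ) + ((σ i : ℕ) : ℤ))
        (fun j => β j - (j : ℕ) + ((τ j : ℕ) : ℤ)) w

/-- The irreducible character of `W_n` attached to a symbol
`[(λ₀ < … < λ_m), (μ₀ < … < μ_{m-1})]` (rows written as increasing sequences, with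
`∑λ + ∑μ = m² + n`): subtract the staircases to get the bipartition. -/
def chiBSymbol (n m : ℕ) (row1 : Fin (m + 1) → ℕ) (row2 : Fin m → ℕ) : (BWn n) → ℂ :=
  chiB n (m + 1) m
    (fun i => (row1 ⟨m - (i : ℕ), by have := i.isLt; omega⟩ : ℤ) - ((m - (i : ℕ) : ℕ) : ℤ))
    (fun j => (row2 ⟨m - 1 - (j : ℕ), by have := j.isLt; omega⟩ : ℤ) -
      ((m - 1 - (j : ℕ) : ℕ) : ℤ))

/-- The irreducible character of `W'_n` (type `D_n`) attached to a symbol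
`[(λ₀ < … < λ_{m-1}), (μ₀ < … < μ_{m-1})]` with distinct rows (`∑λ + ∑μ = m² - m + n`):
the restriction to `W'_n` of the corresponding character of `W_n`. -/
def chiDSymbol (n m : ℕ) (row1 row2 : Fin m → ℕ) : (DWn n) → ℂ :=
  resSub (DWn n) (BWn n)
    (chiB n m m
      (fun i => (row1 ⟨m - 1 - (i : ℕ), by have := i.isLt; omega⟩ : ℤ) -
        ((m - 1 - (i : ℕ) : ℕ) : ℤ))
      (fun j => (row2 ⟨m - 1 - (j : ℕ), by have := j.isLt; omega⟩ : ℤ) -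
        ((m - 1 - (j : ℕ) : ℕ) : ℤ)))

/-- The signed permutation `e_i ↦ s i • e_{p i}`. -/
def mk {n : ℕ} (s : Fin n → ℤˣ) (p : Perm (Fin n)) : PG n where
  toFun
    | Sum.inl i => if s i = 1 then Sum.inl (p i) else Sum.inr (p i)
    | Sum.inr i => if s i = 1 then Sum.inr (p i) else Sum.inl (p i)
  invFun
    | Sum.inl i => if s (p.symm i) = 1 then Sum.inl (p.symm i) else Sum.inr (p.symm i)
    | Sum.inr i => if s (p.symm i) = 1 then Sum.inr (p.symm i) else Sum.inl (p.symm i)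
  left_inv := by
    rintro (i | i) <;> by_cases h : s i = 1 <;> simp [h]
  right_inv := by
    rintro (i | i) <;> by_cases h : s (p.symm i) = 1 <;> simp [h]

section Model
variable {n : ℕ}

theorem mk_inl (s : Fin n → ℤˣ) (p : Perm (Fin n)) (i : Fin n) :
    mk s p (Sum.inl i) = if s i = 1 then Sum.inl (p i) else Sum.inr (p i) := rfl

theorem mk_inr (s : Fin n → ℤˣ) (p : Perm (Fin n)) (i : Fin n) :
    mk s p (Sum.inr i) = if s i = 1 then Sum.inr (p i) else Sum.inl (p i) := rfl

theorem mk_one_one : mk (1 : Fin n → ℤˣ) 1 = 1 := by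
  ext (i | i) <;> simp [mk_inl, mk_inr]

theorem mk_mul (s t : Fin n → ℤˣ) (p q : Perm (Fin n)) :
    mk s p * mk t q = mk (fun i => t i * s (q i)) (p * q) := by
  ext x
  rcases x with i | i <;>
  rcases Int.units_eq_one_or (t i) with h | h <;>
  rcases Int.units_eq_one_or (s (q i)) with h' | h' <;>
  simp [mk_inl, mk_inr, h, h']

theorem mk_inv (s : Fin n → ℤˣ) (p : Perm (Fin n)) :
    (mk s p)⁻¹ = mk (fun i => s (p⁻¹ i)) p⁻¹ := by
  rw [inv_eq_iff_mul_eq_one, mk_mul, ← mk_one_one]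
  congr 1
  · funext i
    rcases Int.units_eq_one_or (s i) with h | h <;> simp
  · simp

theorem mk_injective {s t : Fin n → ℤˣ} {p q : Perm (Fin n)} (h : mk s p = mk t q) :
    s = t ∧ p = q := by
  have key : ∀ i, s i = t i ∧ p i = q i := by
    intro i
    have := congrArg (fun w : PG n => w (Sum.inl i)) h
    simp only [mk_inl] at this
    rcases Int.units_eq_one_or (s i) with h1 | h1 <;>
    rcases Int.units_eq_one_or (t i) with h2 | h2 <;> simp [h1, h2] at this ⊢ <;> exact this
  exact ⟨funext fun i => (key i).1, Equiv.ext fun i => (key i).2⟩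

theorem mk_pow (s : Fin n → ℤˣ) (p : Perm (Fin n)) (k : ℕ) :
    mk s p ^ k = mk (fun i => ∏ j ∈ range k, s ((p ^ j) i)) (p ^ k) := by
  induction k with
  | zero => simp [← mk_one_one]; rfl
  | succ k ih =>
    rw [pow_succ', ih, mk_mul, pow_succ']
    congr 1
    funext i
    rw [prod_range_succ]

theorem dsw_eq (i j : Fin n) : dsw i j = mk 1 (swap i j) := by
  ext x
  rcases x with k | k <;> simp only [dsw, mk_inl, mk_inr, Pi.one_apply, if_true, Perm.mul_apply,
    swap_apply_def] <;> split_ifs <;> simp_all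

theorem ssw_eq (i : Fin n) : ssw i = mk (Pi.mulSingle i (-1)) 1 := by
  ext x
  rcases x with k | k <;> by_cases h : k = i <;>
    simp [ssw, mk_inl, mk_inr, swap_apply_def, h]

theorem msw_eq {i j : Fin n} (hij : i ≠ j) :
    msw i j = mk (Pi.mulSingle i (-1) * Pi.mulSingle j (-1)) (swap i j) := by
  ext x
  rcases x with k | k <;> by_cases h : k = i <;> by_cases h' : k = j <;>
    simp_all [msw, mk_inl, mk_inr, swap_apply_def, Ne.symm hij]

theorem msw_self (i : Fin n) : msw i i = 1 := by
  ext x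
  rcases x with k | k <;> by_cases h : k = i <;>
    simp_all [msw, swap_apply_def]

theorem Mrefl_mk (s : Fin n → ℤˣ) (p : Perm (Fin n)) (i j : Fin n) :
    Mrefl (mk s p) j i = if p i = j then ((s i : ℤ) : ℂ) else 0 := by
  rcases Int.units_eq_one_or (s i) with h | h <;> by_cases h' : p i = j <;>
    simp [Mrefl, mk_inl, h, h']

theorem reflChar_mk (s : Fin n → ℤˣ) (p : Perm (Fin n)) :
    reflChar (mk s p) = ∑ i, if p i = i then ((s i : ℤ) : ℂ) else 0 := by
  simp [reflChar, Matrix.trace, Mrefl_mk]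

theorem sgnChar_mk (s : Fin n → ℤˣ) (p : Perm (Fin n)) :
    sgnChar (mk s p) = ((Perm.sign p : ℤ) : ℂ) * ∏ i, ((s i : ℤ) : ℂ) := by
  have : Mrefl (mk s p) = (Perm.permMatrix ℂ p⁻¹) * Matrix.diagonal fun i => ((s i : ℤ) : ℂ) := by
    ext j i
    rw [Mrefl_mk, Matrix.mul_diagonal]
    by_cases h : p i = j
    · subst h; simp [Perm.permMatrix, PEquiv.toMatrix_apply]
    · have : p.symm j ≠ i := by rintro rfl; simp at h
      simp [h, Perm.permMatrix, PEquiv.toMatrix_apply, this]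
  rw [sgnChar, this, Matrix.det_mul, Matrix.det_permutation, Matrix.det_diagonal]
  simp

/-- The linear character `s ↦ ∏ s_i ^ e_i` of the group of sign vectors. -/
def lam (e : Fin n → ℕ) : (Fin n → ℤˣ) →* ℂ where
  toFun s := ∏ i, ((s i : ℤ) : ℂ) ^ e i
  map_one' := by simp
  map_mul' s t := by simp [mul_pow, prod_mul_distrib]

theorem lam_apply (e : Fin n → ℕ) (s : Fin n → ℤˣ) :
    lam e s = ∏ i, ((s i : ℤ) : ℂ) ^ e i := rfl

theorem lam_add (e e' : Fin n → ℕ) (s : Fin n → ℤˣ) :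
    lam (e + e') s = lam e s * lam e' s := by
  simp [lam_apply, pow_add, prod_mul_distrib]

theorem lam_comp (e : Fin n → ℕ) (s : Fin n → ℤˣ) (p : Perm (Fin n)) (h : e ∘ p = e) :
    lam e (fun i => s (p i)) = lam e s := by
  rw [lam_apply, lam_apply]
  refine Fintype.prod_equiv p _ _ fun i => ?_
  rw [← congrFun h i]; rfl

theorem comp_inv_eq {α β : Type*} {e : α → β} {p : Perm α} : e ∘ ⇑p⁻¹ = e ↔ e ∘ p = e := by
  constructor
  · intro h
    conv_lhs => rw [← h]
    ext i; simp
  · intro h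
    conv_lhs => rw [← h]
    ext i; simp

theorem lam_even {e : Fin n → ℕ} (h : ∀ i, Even (e i)) (s : Fin n → ℤˣ) : lam e s = 1 := by
  rw [lam_apply]
  refine prod_eq_one fun i _ => ?_
  rcases Int.units_eq_one_or (s i) with h1 | h1 <;> simp [h1, (h i).neg_one_pow]

theorem lam_mulSingle (e : Fin n → ℕ) (i : Fin n) : lam e (Pi.mulSingle i (-1)) = (-1) ^ e i := by
  rw [lam_apply, Fintype.prod_eq_single i]
  · simp
  · intro j hj; simp [hj]

theorem even_of_lam_mulSingle {e : Fin n → ℕ} {i : Fin n}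
    (h : lam e (Pi.mulSingle i (-1)) = 1) : Even (e i) := by
  rw [lam_mulSingle] at h
  exact (neg_one_pow_eq_one_iff_even (by norm_num)).1 h

/-- `H` consists of the signed permutations `mk s p` with `s ∈ S` and `p` preserving `f`. -/
def IsSemi (H : Subgroup (PG n)) (S : Subgroup (Fin n → ℤˣ)) (f : Fin n → ℕ) : Prop :=
  ∀ w, w ∈ H ↔ ∃ s ∈ S, ∃ p : Perm (Fin n), f ∘ p = f ∧ w = mk s p

theorem IsSemi.mem {H : Subgroup (PG n)} {S : Subgroup (Fin n → ℤˣ)} {f : Fin n → ℕ}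
    (h : IsSemi H S f) {s : Fin n → ℤˣ} {p : Perm (Fin n)} :
    mk s p ∈ H ↔ s ∈ S ∧ f ∘ p = f := by
  rw [h]
  constructor
  · rintro ⟨t, ht, q, hq, h⟩
    obtain ⟨rfl, rfl⟩ := mk_injective h
    exact ⟨ht, hq⟩
  · rintro ⟨hs, hp⟩
    exact ⟨s, hs, p, hp, rfl⟩

/-- Permutations preserving `f` are products of transpositions preserving `f`. -/
theorem perm_mem_of_swap_mem {f : Fin n → ℕ} (H : Subgroup (Perm (Fin n)))
    (hH : ∀ i j, f i = f j → swap i j ∈ H) (p : Perm (Fin n)) (hp : f ∘ p = f) : p ∈ H := by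
  induction hk : #p.support using Nat.strong_induction_on generalizing p with
  | _ k ih =>
    by_cases h1 : p = 1
    · rw [h1]; exact H.one_mem
    obtain ⟨i, hi⟩ : ∃ i, p i ≠ i := by
      by_contra! h; exact h1 (Equiv.ext h)
    have hf : f i = f (p i) := (congrFun hp i).symm
    have := ih _ (hk ▸ Perm.card_support_swap_mul hi) (swap i (p i) * p) ?_ rfl
    · have h2 := H.mul_mem (hH i (p i) hf) this
      rwa [← mul_assoc, swap_mul_self, one_mul] at h2
    · funext j
      simp only [Function.comp, Perm.mul_apply, swap_apply_def]
      have h3 := congrFun hp j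
      simp only [Function.comp] at h3
      split_ifs with h4 h5
      · rw [← h3, h4, hf]
      · rw [← h3, h5, hf]
      · exact h3

theorem isSemi_blkSub {f : Fin n → ℕ} {ty : Fin n → BTy} (S : Subgroup (Fin n → ℤˣ))
    (hS : ∀ p : Perm (Fin n), f ∘ p = f → ∀ s ∈ S, (fun i => s (p i)) ∈ S)
    (hB : ∀ i, ty i = BTy.B → Pi.mulSingle i (-1) ∈ S)
    (hD : ∀ i j, i ≠ j → f i = f j → ty i = BTy.D → ty j = BTy.D →
      Pi.mulSingle i (-1) * Pi.mulSingle j (-1) ∈ S)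
    (hmem : ∀ s ∈ S, mk s 1 ∈ blkSub n f ty) : IsSemi (blkSub n f ty) S f := by
  have hswap : ∀ i j, f i = f j → f ∘ swap i j = f := by
    intro i j h
    funext k
    simp only [Function.comp, swap_apply_def]
    split_ifs <;> simp_all
  intro w
  constructor
  · intro hw
    unfold blkSub at hw
    induction hw using Subgroup.closure_induction with
    | mem x hx =>
      rcases hx with (⟨i, j, h, rfl⟩ | ⟨i, h, rfl⟩) | ⟨i, j, h, hi, hj, rfl⟩
      · exact ⟨1, S.one_mem, _, hswap i j h, dsw_eq i j⟩
      · exact ⟨_, hB i h, 1, rfl, ssw_eq i⟩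
      · by_cases hij : i = j
        · subst hij
          exact ⟨1, S.one_mem, 1, rfl, by rw [msw_self, mk_one_one]⟩
        · exact ⟨_, hD i j hij h hi hj, _, hswap i j h, msw_eq hij⟩
    | one => exact ⟨1, S.one_mem, 1, rfl, mk_one_one.symm⟩
    | mul x y _ _ hx hy =>
      obtain ⟨s, hs, p, hp, rfl⟩ := hx
      obtain ⟨t, ht, q, hq, rfl⟩ := hy
      refine ⟨_, S.mul_mem ht (hS q hq s hs), p * q, ?_, mk_mul s t p q⟩
      rw [Perm.coe_mul, ← Function.comp_assoc, hp, hq]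
    | inv x _ hx =>
      obtain ⟨s, hs, p, hp, rfl⟩ := hx
      exact ⟨_, hS p⁻¹ (comp_inv_eq.2 hp) s hs, p⁻¹, comp_inv_eq.2 hp, mk_inv s p⟩
  · rintro ⟨s, hs, p, hp, rfl⟩
    let φ : Perm (Fin n) →* PG n :=
      { toFun := fun p => mk 1 p
        map_one' := mk_one_one
        map_mul' := fun p q => by rw [mk_mul]; rfl }
    have h1 : p ∈ (blkSub n f ty).comap φ := by
      refine perm_mem_of_swap_mem _ (fun i j h => ?_) p hp
      change mk 1 (swap i j) ∈ blkSub n f ty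
      rw [← dsw_eq]
      exact Subgroup.subset_closure (Or.inl (Or.inl ⟨i, j, h, rfl⟩))
    have h2 : mk 1 p ∈ blkSub n f ty := h1
    have := (blkSub n f ty).mul_mem h2 (hmem s hs)
    rw [mk_mul] at this
    convert this using 2 <;> first | rfl | simp

theorem mk_mul_left (s t : Fin n → ℤˣ) : mk (s * t) 1 = mk s 1 * mk t 1 := by
  rw [mk_mul]; congr 1; ext i; simp [mul_comm]

theorem ssw_prod (s : Fin n → ℤˣ) : ∏ i, Pi.mulSingle i (s i) = s :=
  Finset.univ_prod_mulSingle s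

theorem isSemi_B (f : Fin n → ℕ) : IsSemi (blkSub n f fun _ => BTy.B) ⊤ f := by
  refine isSemi_blkSub ⊤ (by simp) (by simp) (by simp) fun s _ => ?_
  let φ : (Fin n → ℤˣ) →* PG n :=
    { toFun := fun s => mk s 1
      map_one' := mk_one_one
      map_mul' := mk_mul_left }
  have : s ∈ (blkSub n f fun _ => BTy.B).comap φ := by
    rw [← ssw_prod s]
    refine Subgroup.prod_mem _ fun i _ => ?_
    rcases Int.units_eq_one_or (s i) with h | h
    · rw [h, Pi.mulSingle_one]; exact Subgroup.one_mem _
    · rw [h]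
      change mk _ 1 ∈ blkSub n f fun _ => BTy.B
      rw [← ssw_eq]
      exact Subgroup.subset_closure (Or.inl (Or.inr ⟨i, rfl, rfl⟩))
  exact this

theorem isSemi_S (f : Fin n → ℕ) : IsSemi (blkSub n f fun _ => BTy.S) ⊥ f := by
  refine isSemi_blkSub ⊥ ?_ (by simp) (by simp) ?_
  · intro p _ s hs
    rw [Subgroup.mem_bot] at hs ⊢
    subst hs; rfl
  · intro s hs
    rw [Subgroup.mem_bot] at hs
    subst hs
    rw [mk_one_one]; exact Subgroup.one_mem _

/-- Sign vectors whose product over `{i | c ≤ i}` is one. -/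
def evenSigns (n c : ℕ) : Subgroup (Fin n → ℤˣ) where
  carrier := {s | ∏ i with c ≤ (i : Fin n).val, s i = 1}
  one_mem' := by simp
  mul_mem' := by
    intro a b ha hb
    simp only [Set.mem_ofPred_eq, Pi.mul_apply, prod_mul_distrib] at *
    rw [ha, hb, one_mul]
  inv_mem' := by
    intro a ha
    simp only [Set.mem_ofPred_eq, Pi.inv_apply, prod_inv_distrib] at *
    rw [ha, inv_one]

theorem mem_evenSigns {c : ℕ} {s : Fin n → ℤˣ} :
    s ∈ evenSigns n c ↔ ∏ i with c ≤ (i : Fin n).val, s i = 1 := Iff.rfl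

theorem prod_mulSingle_ge (c : ℕ) (i : Fin n) (a : ℤˣ) :
    ∏ k with c ≤ (k : Fin n).val, (Pi.mulSingle i a : Fin n → ℤˣ) k =
      if c ≤ i.val then a else 1 := by
  simp [Pi.mulSingle_apply]

theorem mulSingle_mem_evenSigns {c : ℕ} {i : Fin n} (hi : i.val < c) :
    Pi.mulSingle i (-1) ∈ evenSigns n c := by
  rw [mem_evenSigns, prod_mulSingle_ge, if_neg (by omega)]

theorem mulSingle_mul_mem_evenSigns {c : ℕ} {i j : Fin n} (hi : c ≤ i.val) (hj : c ≤ j.val) :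
    Pi.mulSingle i (-1) * Pi.mulSingle j (-1) ∈ evenSigns n c := by
  rw [mem_evenSigns]
  simp only [Pi.mul_apply, prod_mul_distrib]
  rw [prod_mulSingle_ge, prod_mulSingle_ge, if_pos hi, if_pos hj]
  simp

theorem isSemi_BD {c : ℕ} {f : Fin n → ℕ} (hf : ∀ i j, f i = f j ↔ (i.val < c ↔ j.val < c)) :
    IsSemi (blkSub n f fun i => if (i : ℕ) < c then BTy.B else BTy.D) (evenSigns n c) f := by
  set H := blkSub n f fun i => if (i : ℕ) < c then BTy.B else BTy.D with hH
  refine isSemi_blkSub _ ?_ ?_ ?_ ?_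
  · intro p hp s hs
    rw [mem_evenSigns] at hs ⊢
    rw [← hs]
    refine Finset.prod_equiv p (fun i => ?_) fun i _ => rfl
    have := (hf (p i) i).1 (congrFun hp i)
    simp only [mem_filter, mem_univ, true_and]
    omega
  · intro i hi
    refine mulSingle_mem_evenSigns ?_
    by_contra h
    simp [h] at hi
  · intro i j _ _ hi hj
    refine mulSingle_mul_mem_evenSigns ?_ ?_ <;> by_contra h
    · simp at h; simp [h] at hi
    · simp at h; simp [h] at hj
  · intro s hs
    induction hk : #(univ.filter fun i => s i ≠ 1) using Nat.strong_induction_on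
      generalizing s with
    | _ k ih =>
      have flip : ∀ (t : Fin n → ℤˣ), t ∈ evenSigns n c → mk t 1 ∈ H →
          (∃ i, s i ≠ 1 ∧ t i ≠ 1) → (∀ i, t i ≠ 1 → s i ≠ 1) → mk s 1 ∈ H := by
        intro t ht htH ⟨i, hi, hi'⟩ hsub
        have h1 : mk (t * s) 1 ∈ H := by
          refine ih _ ?_ _ ((evenSigns n c).mul_mem ht hs) rfl
          rw [← hk]
          refine card_lt_card ⟨fun j => ?_, fun h => ?_⟩
          · simp only [mem_filter, mem_univ, true_and, Pi.mul_apply]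
            intro h
            rcases Int.units_eq_one_or (t j) with h' | h'
            · simpa [h'] using h
            · exact hsub j (by simp [h'])
          · have := h (mem_filter.2 ⟨mem_univ i, hi⟩)
            simp only [mem_filter, mem_univ, true_and, Pi.mul_apply] at this
            rw [Int.units_ne_iff_eq_neg.1 hi, Int.units_ne_iff_eq_neg.1 hi'] at this
            simp at this
        have h2 := H.mul_mem htH h1
        rw [← mk_mul_left] at h2
        convert h2 using 2
        ext j
        simp [← mul_assoc, Int.units_mul_self]
      by_cases hA : ∃ i : Fin n, i.val < c ∧ s i ≠ 1
      · obtain ⟨i, hi, hsi⟩ := hA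
        refine flip (Pi.mulSingle i (-1)) (mulSingle_mem_evenSigns hi) ?_
          ⟨i, hsi, by simp⟩ ?_
        · rw [← ssw_eq]
          exact Subgroup.subset_closure (Or.inl (Or.inr ⟨i, by simp [hi], rfl⟩))
        · intro j hj
          by_cases h : j = i
          · rwa [h]
          · simp [h] at hj
      push Not at hA
      by_cases h1 : s = 1
      · rw [h1, mk_one_one]; exact H.one_mem
      obtain ⟨i, hi⟩ : ∃ i, s i ≠ 1 := by
        by_contra! h; exact h1 (funext h)
      have hic : c ≤ i.val := by
        by_contra h; exact hi (hA i (by omega))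
      obtain ⟨j, hj, hij⟩ : ∃ j, s j ≠ 1 ∧ j ≠ i := by
        by_contra! h
        rw [mem_evenSigns, prod_eq_single_of_mem i (by simp [hic])] at hs
        · exact hi hs
        · intro k _ hk; by_contra h'; exact hk (h k h')
      have hjc : c ≤ j.val := by
        by_contra h; exact hj (hA j (by omega))
      have hfij : f i = f j := (hf i j).2 (by omega)
      refine flip (Pi.mulSingle i (-1) * Pi.mulSingle j (-1))
        (mulSingle_mul_mem_evenSigns hic hjc) ?_ ⟨i, hi, ?_⟩ ?_
      · have e1 : msw i j ∈ H := Subgroup.subset_closure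
          (Or.inr ⟨i, j, hfij, by simp [hic], by simp [hjc], rfl⟩)
        have e2 : dsw i j ∈ H := Subgroup.subset_closure
          (Or.inl (Or.inl ⟨i, j, hfij, rfl⟩))
        have e3 := H.mul_mem e2 e1
        rw [dsw_eq, msw_eq hij.symm, mk_mul] at e3
        convert e3 using 2
        · ext k; simp
        · simp
      · simp [hij.symm]
      · intro k hk
        by_cases h : k = i
        · rwa [h]
        by_cases h' : k = j
        · rwa [h']
        simp [h, h'] at hk

end Model

section Sums
variable {n : ℕ}

/-- The permutations preserving `f`. -/
def stab (f : Fin n → ℕ) : Finset (Perm (Fin n)) :=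
  univ.filter fun p : Perm (Fin n) => f ∘ ⇑p = f

theorem mem_stab {f : Fin n → ℕ} {p : Perm (Fin n)} : p ∈ stab f ↔ f ∘ p = f := by
  simp [stab]

theorem IsSemi.bijective {H : Subgroup (PG n)} {S : Subgroup (Fin n → ℤˣ)} {f : Fin n → ℕ}
    (h : IsSemi H S f) :
    Function.Bijective fun x : S × {p : Perm (Fin n) // f ∘ ⇑p = f} =>
      (⟨mk x.1 x.2, h.mem.2 ⟨x.1.2, x.2.2⟩⟩ : H) := by
  constructor
  · rintro ⟨s, p⟩ ⟨t, q⟩ hst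
    obtain ⟨h1, h2⟩ := mk_injective (congrArg Subtype.val hst)
    exact Prod.ext (Subtype.ext h1) (Subtype.ext h2)
  · rintro ⟨w, hw⟩
    obtain ⟨s, hs, p, hp, rfl⟩ := (h w).1 hw
    exact ⟨⟨⟨s, hs⟩, ⟨p, hp⟩⟩, rfl⟩

theorem IsSemi.finsum_eq {H : Subgroup (PG n)} {S : Subgroup (Fin n → ℤˣ)} {f : Fin n → ℕ}
    [Fintype S] (h : IsSemi H S f) (F : H → ℂ) (F' : (Fin n → ℤˣ) → Perm (Fin n) → ℂ)
    (hF : ∀ s p (hw : mk s p ∈ H), F ⟨mk s p, hw⟩ = F' s p) :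
    ∑ᶠ g : H, F g = ∑ p ∈ stab f, ∑ s : S, F' s p := by
  rw [← finsum_eq_of_bijective (f := fun x : S × {p : Perm (Fin n) // f ∘ ⇑p = f} =>
    F' x.1 x.2) _ h.bijective (fun x => (hF _ _ _).symm), finsum_eq_sum_of_fintype,
    Fintype.sum_prod_type_right]
  exact (Finset.sum_subtype (stab f) (fun _ => mem_stab)
    (fun p => ∑ s : S, F' s p)).symm

theorem IsSemi.card_eq {H : Subgroup (PG n)} {S : Subgroup (Fin n → ℤˣ)} {f : Fin n → ℕ}
    [Fintype S] (h : IsSemi H S f) :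
    (Nat.card H : ℂ) = #(stab f) * (Fintype.card S : ℂ) := by
  rw [← Nat.card_congr (Equiv.ofBijective _ h.bijective), Nat.card_prod,
    Nat.card_eq_fintype_card (α := S),
    Nat.card_eq_fintype_card (α := {p : Perm (Fin n) // f ∘ p = f}),
    Fintype.card_subtype fun p : Perm (Fin n) => f ∘ p = f, stab,
    Nat.cast_mul, mul_comm]

theorem card_perm_ne_zero (f : Fin n → ℕ) : (#(stab f) : ℂ) ≠ 0 := by
  rw [Nat.cast_ne_zero]
  exact (card_pos.2 ⟨1, mem_stab.2 rfl⟩).ne'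

theorem IsSemi.cinner_eq {H : Subgroup (PG n)} {S : Subgroup (Fin n → ℤˣ)} {f : Fin n → ℕ}
    [Fintype S] (h : IsSemi H S f) (φ ψ : H → ℂ) (φ' ψ' : (Fin n → ℤˣ) → Perm (Fin n) → ℂ)
    (hφ : ∀ s p (hw : mk s p ∈ H), φ ⟨mk s p, hw⟩ = φ' s p)
    (hψ : ∀ s p (hw : mk s p ∈ H), ψ ⟨mk s p, hw⟩ = ψ' s p)
    (hinv : ∀ s p, ψ' (fun i => s (p⁻¹ i)) p⁻¹ = ψ' s p) :
    cinner φ ψ = (#(stab f) : ℂ)⁻¹ * (Fintype.card S : ℂ)⁻¹ *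
      ∑ p ∈ stab f, ∑ s : S, φ' s p * ψ' s p := by
  rw [cinner, h.card_eq, mul_inv, h.finsum_eq _ fun s p => φ' s p * ψ' s p]
  intro s p hw
  have : (⟨mk s p, hw⟩ : H)⁻¹ = ⟨mk (fun i => s (p⁻¹ i)) p⁻¹, by
    rw [← mk_inv]; exact H.inv_mem hw⟩ := Subtype.ext (mk_inv s p)
  rw [hφ, this, hψ, hinv]

/-- Summing a linear character over a group of sign vectors. -/
theorem sum_lam (S : Subgroup (Fin n → ℤˣ)) [Fintype S] (e : Fin n → ℕ)
    [Decidable (∀ s ∈ S, lam e s = 1)] :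
    ∑ s : S, lam e s = if ∀ s ∈ S, lam e s = 1 then (Fintype.card S : ℂ) else 0 := by
  classical
  have := sum_hom_units ((lam e).comp S.subtype)
  simp only [MonoidHom.comp_apply, Subgroup.subtype_apply] at this
  rw [this]
  have h : (lam e).comp S.subtype = 1 ↔ ∀ s ∈ S, lam e s = 1 := by
    rw [MonoidHom.ext_iff]; simp
  simp only [h]
  push_cast
  rfl

theorem sum_sign (f m : Fin n → ℕ) [Decidable (∀ i j, f i = f j → m i = m j → i = j)] :
    ∑ p ∈ (stab f).filter fun p : Perm (Fin n) => m ∘ ⇑p = m, ((Perm.sign p : ℤ) : ℂ) =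
      if ∀ i j, f i = f j → m i = m j → i = j then 1 else 0 := by
  split_ifs with h
  · have h1 : (1 : Perm (Fin n)) ∈ (stab f).filter fun p : Perm (Fin n) => m ∘ ⇑p = m := by
      rw [mem_filter, mem_stab]
      exact ⟨rfl, rfl⟩
    rw [sum_eq_single_of_mem 1 h1]
    · simp
    · intro p hp hp1
      simp only [mem_filter, mem_stab] at hp
      exact absurd (Equiv.ext fun i => h (p i) i (congrFun hp.1 i) (congrFun hp.2 i)) hp1
  · push Not at h
    obtain ⟨i, j, hf, hm, hij⟩ := h
    have hs : ∀ g : Fin n → ℕ, g i = g j → ∀ k, g (swap i j k) = g k := by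
      intro g hg k
      simp only [swap_apply_def]
      split_ifs <;> simp_all
    refine sum_involution (fun p _ => swap i j * p) ?_ ?_ ?_ ?_
    · intro p _
      simp [Perm.sign_swap hij]
    · intro p _ _ h
      exact hij (swap_eq_one_iff.1 (mul_eq_right.1 h))
    · intro p hp
      simp only [mem_filter, mem_stab] at hp ⊢
      refine ⟨funext fun k => ?_, funext fun k => ?_⟩
      · simpa [hs f hf] using congrFun hp.1 k
      · simpa [hs m hm] using congrFun hp.2 k
    · intro p _
      simp [← mul_assoc]

end Sums

section Sym
variable {n : ℕ}

/-- The trace of a signed permutation on homogeneous polynomials of degree `d`. -/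
def symTr (d : ℕ) (s : Fin n → ℤˣ) (p : Perm (Fin n)) : ℂ :=
  ∑ m ∈ (piAntidiag univ d).filter fun m : Fin n → ℕ => m ∘ ⇑p = m, lam m s

/-- The exponent vector counting visits of the first `k` iterates of `p` starting at `i`. -/
def visits (p : Perm (Fin n)) (i : Fin n) (k : ℕ) : Fin n → ℕ :=
  ∑ j ∈ range k, Pi.single (p^[j] i) 1

theorem visits_apply (p : Perm (Fin n)) (i : Fin n) (k : ℕ) (x : Fin n) :
    visits p i k x = #{j ∈ range k | p^[j] i = x} := by
  simp [visits, Finset.sum_apply, Pi.single_apply, eq_comm]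

theorem lam_visits (p : Perm (Fin n)) (i : Fin n) (k : ℕ) (s : Fin n → ℤˣ) :
    lam (visits p i k) s = ((∏ j ∈ range k, s (p^[j] i) : ℤˣ) : ℤ) := by
  induction k with
  | zero => simp [visits, lam_apply]
  | succ k ih =>
    have : visits p i (k + 1) = visits p i k + Pi.single (p^[k] i) 1 := by
      rw [visits, sum_range_succ]; rfl
    rw [this, lam_add, ih, prod_range_succ]
    push_cast
    congr 1
    rw [lam_apply, Fintype.prod_eq_single (p^[k] i)]
    · simp
    · intro j hj; simp [hj]

theorem sum_visits (p : Perm (Fin n)) (i : Fin n) (k : ℕ) : ∑ x, visits p i k x = k := by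
  simp only [visits, Finset.sum_apply]
  rw [sum_comm]
  simp

theorem visits_comp {p : Perm (Fin n)} {i : Fin n} {k : ℕ} (h : p^[k] i = i) :
    visits p i k ∘ p = visits p i k := by
  have e1 : ∀ j x, (Pi.single (p^[j + 1] i) 1 : Fin n → ℕ) (p x) =
      (Pi.single (p^[j] i) 1 : Fin n → ℕ) x := by
    intro j x
    simp [Pi.single_apply, Function.iterate_succ_apply']
  funext x
  simp only [Function.comp, visits, Finset.sum_apply]
  have h1 := sum_range_succ (fun j => (Pi.single (p^[j] i) 1 : Fin n → ℕ) (p x)) k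
  have h2 := sum_range_succ' (fun j => (Pi.single (p^[j] i) 1 : Fin n → ℕ) (p x)) k
  simp only [e1, h, Function.iterate_zero, id] at h1 h2
  omega

theorem visits_mul_minimalPeriod (p : Perm (Fin n)) (i : Fin n) (a : ℕ) (x : Fin n) :
    visits p i (Function.minimalPeriod p i * a) x =
      a * visits p i (Function.minimalPeriod p i) x := by
  induction a with
  | zero => simp [visits]
  | succ a ih =>
    rw [mul_add_one, visits, sum_range_add (fun j => (Pi.single (p^[j] i) 1 : Fin n → ℕ)),
      Pi.add_apply, Nat.succ_mul, ← ih]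
    congr 1
    rw [visits]
    refine congrFun (sum_congr rfl fun j _ => ?_) x
    rw [add_comm, Function.iterate_add_apply]
    congr 2
    exact (Function.isPeriodicPt_minimalPeriod p i).mul_const a

theorem visits_minimalPeriod_le (p : Perm (Fin n)) (i x : Fin n) :
    visits p i (Function.minimalPeriod p i) x ≤ 1 := by
  rw [visits_apply, card_le_one]
  intro a ha b hb
  simp only [mem_filter, mem_range] at ha hb
  exact Function.iterate_injOn_Iio_minimalPeriod (f := p) (x := i) ha.1 hb.1 (ha.2.trans hb.2.symm)

theorem minimalPeriod_perm_pos (p : Perm (Fin n)) (i : Fin n) :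
    0 < Function.minimalPeriod p i :=
  Function.minimalPeriod_pos_of_mem_periodicPts (p.injective.mem_periodicPts i)

theorem visits_minimalPeriod_self (p : Perm (Fin n)) (i : Fin n) :
    visits p i (Function.minimalPeriod p i) i = 1 := by
  refine le_antisymm (visits_minimalPeriod_le p i i) ?_
  rw [visits_apply, Nat.one_le_iff_ne_zero, card_ne_zero]
  exact ⟨0, by simp [minimalPeriod_perm_pos]⟩

theorem comp_iterate {m : Fin n → ℕ} {p : Perm (Fin n)} (hm : m ∘ ⇑p = m) (j : ℕ) (i : Fin n) :
    m (p^[j] i) = m i := by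
  induction j with
  | zero => rfl
  | succ j ih => rw [Function.iterate_succ_apply', ← ih]; exact congrFun hm _

theorem visits_le_iff {p : Perm (Fin n)} {i : Fin n} {m : Fin n → ℕ} (hm : m ∘ ⇑p = m) (a : ℕ) :
    (∀ x, visits p i (Function.minimalPeriod p i * a) x ≤ m x) ↔ a ≤ m i := by
  constructor
  · intro h
    have := h i
    rwa [visits_mul_minimalPeriod, visits_minimalPeriod_self, mul_one] at this
  · intro h x
    rw [visits_mul_minimalPeriod]
    by_cases hx : visits p i (Function.minimalPeriod p i) x = 0
    · simp [hx]
    have h1 : visits p i (Function.minimalPeriod p i) x = 1 :=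
      le_antisymm (visits_minimalPeriod_le p i x) (Nat.one_le_iff_ne_zero.2 hx)
    rw [visits_apply, ← Ne, card_ne_zero] at hx
    obtain ⟨j, hj⟩ := hx
    rw [h1, mul_one, ← (mem_filter.1 hj).2, comp_iterate hm]
    exact h

theorem card_visits_le {p : Perm (Fin n)} {i : Fin n} {m : Fin n → ℕ} (hm : m ∘ ⇑p = m) {d : ℕ}
    (hd : ∑ x, m x = d) :
    #{k ∈ range d | p^[k + 1] i = i ∧ (∀ x, visits p i (k + 1) x ≤ m x)} = m i := by
  have hpos := minimalPeriod_perm_pos p i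
  rw [← card_range (m i)]
  symm
  refine card_bij (fun a _ => Function.minimalPeriod p i * (a + 1) - 1) ?_ ?_ ?_
  · intro a ha
    have hpos' : 0 < Function.minimalPeriod p i * (a + 1) := by positivity
    have hle := (visits_le_iff (i := i) hm (a + 1)).2 (mem_range.1 ha)
    simp only [mem_filter, mem_range, Nat.sub_add_cancel hpos']
    refine ⟨?_, (Function.isPeriodicPt_minimalPeriod p i).mul_const _, hle⟩
    have : Function.minimalPeriod p i * (a + 1) ≤ d := by
      rw [← hd, ← sum_visits p i (Function.minimalPeriod p i * (a + 1))]
      exact sum_le_sum fun x _ => hle x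
    omega
  · intro a _ b _ hab
    have h1 : 0 < Function.minimalPeriod p i * (a + 1) := by positivity
    have h2 : 0 < Function.minimalPeriod p i * (b + 1) := by positivity
    have h3 : Function.minimalPeriod p i * (a + 1) = Function.minimalPeriod p i * (b + 1) := by
      omega
    have := Nat.eq_of_mul_eq_mul_left hpos h3
    omega
  · intro k hk
    simp only [mem_filter, mem_range] at hk
    obtain ⟨a, ha⟩ := Function.IsPeriodicPt.minimalPeriod_dvd (f := p) (x := i) hk.2.1
    have ha0 : a ≠ 0 := by rintro rfl; simp at ha
    obtain ⟨b, rfl⟩ := Nat.exists_eq_succ_of_ne_zero ha0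
    refine ⟨b, ?_, ?_⟩
    · rw [mem_range]
      exact (visits_le_iff hm (b + 1)).1 (ha ▸ hk.2.2)
    · change _ = _ * (b + 1) at ha
      omega

theorem lam_visits_mul_symTr {p : Perm (Fin n)} {i : Fin n} {k d : ℕ} (h : p^[k] i = i)
    (hk : k ≤ d) (s : Fin n → ℤˣ) :
    lam (visits p i k) s * symTr (d - k) s p =
      ∑ m ∈ (piAntidiag univ d).filter fun m : Fin n → ℕ => m ∘ ⇑p = m,
        if ∀ x, visits p i k x ≤ m x then lam m s else 0 := by
  rw [symTr, mul_sum, ← sum_filter]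
  have hc := visits_comp h
  refine sum_nbij' (fun m => visits p i k + m) (fun m => m - visits p i k) ?_ ?_ ?_ ?_ ?_
  · intro m hm
    simp only [mem_filter, mem_piAntidiag, mem_univ, implies_true, and_true] at hm ⊢
    refine ⟨⟨?_, ?_⟩, fun x => by simp⟩
    · simp only [Pi.add_apply, sum_add_distrib, sum_visits, hm.1]
      omega
    · funext x
      have h1 := congrFun hc x
      have h2 := congrFun hm.2 x
      simp only [Function.comp, Pi.add_apply] at *
      rw [h1, h2]
  · intro m hm
    simp only [mem_filter, mem_piAntidiag, mem_univ, implies_true, and_true] at hm ⊢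
    refine ⟨?_, ?_⟩
    · have : ∑ x, visits p i k x + univ.sum (m - visits p i k) = ∑ x, m x := by
        rw [← sum_add_distrib]
        refine sum_congr rfl fun x _ => ?_
        have := hm.2 x
        simp only [Pi.sub_apply]
        omega
      rw [sum_visits, hm.1.1] at this
      omega
    · funext x
      have h1 := congrFun hc x
      have h2 := congrFun hm.1.2 x
      simp only [Function.comp, Pi.sub_apply] at *
      rw [h1, h2]
  · intro m _
    simp
  · intro m hm
    simp only [mem_filter] at hm
    funext x
    have := hm.2 x
    simp only [Pi.add_apply, Pi.sub_apply]
    omega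
  · intro m _
    rw [lam_add]

theorem reflChar_mk_pow (s : Fin n → ℤˣ) (p : Perm (Fin n)) (k : ℕ) :
    reflChar (mk s p ^ k) = ∑ i, if p^[k] i = i then lam (visits p i k) s else 0 := by
  rw [mk_pow, reflChar_mk]
  simp only [lam_visits, Perm.iterate_eq_pow]

theorem symChar_mk (d : ℕ) (s : Fin n → ℤˣ) (p : Perm (Fin n)) :
    symChar reflChar d (mk s p) = symTr d s p := by
  induction d using Nat.strong_induction_on with
  | _ d ih =>
    rcases d with _ | d
    · rw [symChar, symTr]
      have : (piAntidiag univ 0).filter (fun m : Fin n → ℕ => m ∘ ⇑p = m) = {0} := by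
        ext m
        simp only [piAntidiag_zero, mem_filter, mem_singleton, and_iff_left_iff_imp]
        rintro rfl; rfl
      rw [this]
      simp [lam_apply]
    · rw [symChar]
      have h1 : ∑ k ∈ range (d + 1), reflChar (mk s p ^ (k + 1)) * symChar reflChar (d - k) (mk s p)
          = ∑ k ∈ range (d + 1), ∑ i, ∑ m ∈ (piAntidiag univ (d + 1)).filter
            fun m : Fin n → ℕ => m ∘ ⇑p = m,
            if p^[k + 1] i = i ∧ (∀ x, visits p i (k + 1) x ≤ m x) then lam m s else 0 := by
        refine sum_congr rfl fun k hk => ?_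
        rw [mem_range] at hk
        rw [ih _ (by omega), reflChar_mk_pow, sum_mul]
        refine sum_congr rfl fun i _ => ?_
        by_cases h : p^[k + 1] i = i
        · rw [if_pos h]
          have := lam_visits_mul_symTr (d := d + 1) h (by omega) s
          rw [show d + 1 - (k + 1) = d - k by omega] at this
          rw [this]
          simp [h]
        · simp only [h, if_false, zero_mul, false_and, sum_const_zero]
      rw [h1, sum_comm]
      have h2 : ∀ i : Fin n, ∑ k ∈ range (d + 1), ∑ m ∈ (piAntidiag univ (d + 1)).filter
            (fun m : Fin n → ℕ => m ∘ ⇑p = m),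
            (if p^[k + 1] i = i ∧ (∀ x, visits p i (k + 1) x ≤ m x) then lam m s else 0) =
          ∑ m ∈ (piAntidiag univ (d + 1)).filter
            (fun m : Fin n → ℕ => m ∘ ⇑p = m), (m i : ℂ) * lam m s := by
        intro i
        rw [sum_comm]
        refine sum_congr rfl fun m hm => ?_
        simp only [mem_filter, mem_piAntidiag, mem_univ, implies_true, and_true] at hm
        rw [← sum_filter, sum_const, card_visits_le hm.2 hm.1, nsmul_eq_mul]
      rw [sum_congr rfl fun i _ => h2 i, sum_comm, symTr, mul_sum]
      refine sum_congr rfl fun m hm => ?_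
      simp only [mem_filter, mem_piAntidiag, mem_univ, implies_true, and_true] at hm
      rw [← sum_mul, ← Nat.cast_sum, hm.1, ← mul_assoc]
      push_cast
      rw [inv_mul_cancel₀ (Nat.cast_add_one_ne_zero d), one_mul]

theorem symChar_resChar {G : Type} [Group G] (H : Subgroup G) (χ : G → ℂ) (d : ℕ) (h : H) :
    symChar (resChar H χ) d h = symChar χ d h := by
  induction d using Nat.strong_induction_on with
  | _ d ih =>
    rcases d with _ | d
    · rw [symChar, symChar]
    · rw [symChar, symChar]
      congr 1
      refine sum_congr rfl fun k _ => ?_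
      rw [ih _ (by omega)]
      rfl

theorem symTr_inv (d : ℕ) (s : Fin n → ℤˣ) (p : Perm (Fin n)) :
    symTr d (fun i => s (p⁻¹ i)) p⁻¹ = symTr d s p := by
  rw [symTr, symTr]
  refine sum_congr (by simp only [comp_inv_eq]) fun m hm => ?_
  simp only [mem_filter] at hm
  exact lam_comp m s p⁻¹ (comp_inv_eq.2 hm.2)

end Sym

section Mult
variable {n : ℕ}

theorem resChar_sgnChar_mk {H : Subgroup (PG n)} (s : Fin n → ℤˣ) (p : Perm (Fin n))
    (h : mk s p ∈ H) : resChar H sgnChar ⟨mk s p, h⟩ = ((Perm.sign p : ℤ) : ℂ) * lam 1 s := by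
  simp [resChar, sgnChar_mk, lam_apply]

theorem symChar_resChar_mk {H : Subgroup (PG n)} (d : ℕ) (s : Fin n → ℤˣ) (p : Perm (Fin n))
    (h : mk s p ∈ H) : symChar (resChar H reflChar) d ⟨mk s p, h⟩ = symTr d s p := by
  rw [symChar_resChar, symChar_mk]

open scoped Classical in
/-- The multiplicity of the sign character in the `d`-th symmetric power. -/
theorem bMult_sgn {H : Subgroup (PG n)} {S : Subgroup (Fin n → ℤˣ)} {f : Fin n → ℕ}
    (h : IsSemi H S f) (d : ℕ) :
    bMult (resChar H reflChar) (resChar H sgnChar) d = (#(stab f) : ℂ)⁻¹ *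
      #{m ∈ piAntidiag univ d | (∀ i j, f i = f j → m i = m j → i = j) ∧
        ∀ s ∈ S, lam (1 + m) s = 1} := by
  have hS : (Fintype.card S : ℂ) ≠ 0 := by simp
  rw [bMult, h.cinner_eq _ _
    (fun (s : Fin n → ℤˣ) (p : Perm (Fin n)) => ((Perm.sign p : ℤ) : ℂ) * lam 1 s) (symTr d)
    resChar_sgnChar_mk (symChar_resChar_mk d) (symTr_inv d), mul_assoc]
  congr 1
  have h1 : ∀ p : Perm (Fin n), ∑ s : S,
      ((Perm.sign p : ℤ) : ℂ) * lam 1 (s : Fin n → ℤˣ) * symTr d s p =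
      (Fintype.card S : ℂ) * ∑ m ∈ piAntidiag univ d with ∀ s ∈ S, lam (1 + m) s = 1,
        if m ∘ p = m then ((Perm.sign p : ℤ) : ℂ) else 0 := by
    intro p
    simp only [symTr, mul_sum, mul_assoc, ← lam_add]
    rw [sum_comm]
    simp only [← mul_sum, sum_lam]
    simp only [sum_filter, mul_sum]
    refine sum_congr rfl fun m _ => ?_
    split_ifs <;> ring
  rw [sum_congr rfl fun p _ => h1 p, ← mul_sum, ← mul_assoc, inv_mul_cancel₀ hS, one_mul, sum_comm]
  rw [sum_congr rfl fun m _ => (sum_filter _ _).symm.trans (sum_sign f m)]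
  rw [← sum_filter, filter_filter, sum_const, nsmul_eq_mul, mul_one]
  simp only [and_comm]

/-- The indicator exponent vector of a set of coordinates. -/
def ind (T : Finset (Fin n)) : Fin n → ℕ := fun i => if i ∈ T then 1 else 0

theorem ind_injective : Function.Injective (ind (n := n)) := by
  intro T U h
  ext i
  have := congrFun h i
  simp only [ind] at this
  split_ifs at this <;> simp_all

theorem ind_comp_eq_iff (T U : Finset (Fin n)) (p : Perm (Fin n)) :
    ind T ∘ ⇑p = ind U ↔ T = U.map p.toEmbedding := by
  rw [← ind_injective.eq_iff]
  constructor
  · intro h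
    funext i
    have := congrFun h (p.symm i)
    simp only [Function.comp, apply_symm_apply] at this
    rw [this]
    simp [ind]
  · intro h
    rw [h]
    funext i
    simp [ind]

/-- The character induced from `W_c × W_{n-c}` of the linear character
`sign ⊗ (signs of the coordinates in the first block)`. -/
def chiF (c : ℕ) (s : Fin n → ℤˣ) (p : Perm (Fin n)) : ℂ :=
  ((Perm.sign p : ℤ) : ℂ) *
    ∑ T ∈ (powersetCard c univ).filter fun T : Finset (Fin n) => ind T ∘ ⇑p = ind T, lam (ind T) s

theorem chiF_inv (c : ℕ) (s : Fin n → ℤˣ) (p : Perm (Fin n)) :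
    chiF c (fun i => s (p⁻¹ i)) p⁻¹ = chiF c s p := by
  rw [chiF, chiF, Perm.sign_inv]
  congr 1
  refine sum_congr (by simp only [comp_inv_eq]) fun T hT => ?_
  simp only [mem_filter] at hT
  exact lam_comp _ s p⁻¹ (comp_inv_eq.2 hT.2)

/-- The coordinates with odd exponent. -/
def oddSet (m : Fin n → ℕ) : Finset (Fin n) := {i | Odd (m i)}

theorem oddSet_inv {m : Fin n → ℕ} {p : Perm (Fin n)} (h : m ∘ p = m) :
    ind (oddSet m) ∘ p = ind (oddSet m) := by
  funext i
  simp only [ind, oddSet, Function.comp, mem_filter, mem_univ, true_and]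
  rw [show m (p i) = m i from congrFun h i]

theorem lam_ind_add_eq_one_iff {T : Finset (Fin n)} {m : Fin n → ℕ} :
    (∀ s ∈ (⊤ : Subgroup (Fin n → ℤˣ)), lam (ind T + m) s = 1) ↔ oddSet m = T := by
  constructor
  · intro h
    ext i
    have := even_of_lam_mulSingle (h (Pi.mulSingle i (-1)) trivial)
    simp only [Pi.add_apply, ind] at this
    simp only [oddSet, mem_filter, mem_univ, true_and]
    split_ifs at this with hi
    · simp only [hi, iff_true]
      rw [add_comm] at this
      exact Nat.not_even_iff_odd.1 (Nat.even_add_one.1 this)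
    · simp only [hi, iff_false, Nat.not_odd_iff_even]
      simpa using this
  · rintro rfl s -
    refine lam_even (fun i => ?_) s
    simp only [Pi.add_apply, ind, oddSet, mem_filter, mem_univ, true_and]
    split_ifs with hi
    · exact odd_one.add_odd hi
    · simpa using hi

theorem oddSet_ind (T : Finset (Fin n)) : oddSet (ind T) = T := by
  ext i
  rw [oddSet, mem_filter]
  by_cases h : i ∈ T <;> simp [ind, h]

open scoped Classical in
theorem bMult_chiF {H : Subgroup (PG n)} {f : Fin n → ℕ}
    (h : IsSemi H ⊤ f) (c d : ℕ) (χ : H → ℂ)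
    (hχ : ∀ s p (hw : mk s p ∈ H), χ ⟨mk s p, hw⟩ = chiF c s p) :
    bMult (resChar H reflChar) χ d = (#(stab f) : ℂ)⁻¹ *
      #{m ∈ piAntidiag univ d | (∀ i j, f i = f j → m i = m j → i = j) ∧ #(oddSet m) = c} := by
  have hS : (Fintype.card (⊤ : Subgroup (Fin n → ℤˣ)) : ℂ) ≠ 0 := by simp
  rw [bMult, h.cinner_eq _ _ (chiF c) (symTr d) hχ (symChar_resChar_mk d) (symTr_inv d), mul_assoc]
  congr 1
  have h1 : ∀ p : Perm (Fin n), ∑ s : (⊤ : Subgroup (Fin n → ℤˣ)), chiF c s p * symTr d s p =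
      (Fintype.card (⊤ : Subgroup (Fin n → ℤˣ)) : ℂ) *
        ∑ m ∈ piAntidiag univ d with #(oddSet m) = c,
          if m ∘ p = m then ((Perm.sign p : ℤ) : ℂ) else 0 := by
    intro p
    simp only [symTr, chiF, mul_assoc, sum_mul_sum, ← lam_add, ← mul_sum]
    rw [sum_comm]
    simp only [sum_comm (γ := (⊤ : Subgroup (Fin n → ℤˣ))), sum_lam, lam_ind_add_eq_one_iff]
    rw [sum_comm, sum_filter, mul_sum, mul_sum, sum_filter]
    refine sum_congr rfl fun m _ => ?_
    by_cases hm : m ∘ p = m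
    · simp only [hm, if_true]
      rw [sum_ite_eq]
      simp only [mem_filter, mem_powersetCard_univ, oddSet_inv hm, and_true]
      split_ifs <;> ring
    · simp [hm]
  rw [sum_congr rfl fun p _ => h1 p, ← mul_sum, ← mul_assoc, inv_mul_cancel₀ hS, one_mul, sum_comm]
  rw [sum_congr rfl fun m _ => (sum_filter _ _).symm.trans (sum_sign f m)]
  rw [← sum_filter, filter_filter, sum_const, nsmul_eq_mul, mul_one]
  simp only [and_comm]

theorem exists_perm_comp_eq {β : Type*} [DecidableEq β] (f g : Fin n → β)
    (h : ∀ b, #{i | f i = b} = #{i | g i = b}) : ∃ q : Perm (Fin n), f ∘ q = g := by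
  have e : ∀ b, Nonempty ({i // g i = b} ≃ {i // f i = b}) := fun b => by
    refine ⟨Fintype.equivOfCardEq ?_⟩
    rw [Fintype.card_subtype, Fintype.card_subtype, h]
  exact ⟨Equiv.ofFiberEquiv fun b => (e b).some, funext fun i => Equiv.ofFiberEquiv_map _ i⟩

theorem card_perm_comp_eq {β : Type*} [DecidableEq β] (f g : Fin n → β)
    (h : ∀ b, #{i | f i = b} = #{i | g i = b}) :
    #(univ.filter fun p : Perm (Fin n) => f ∘ ⇑p = g) =
      #(univ.filter fun p : Perm (Fin n) => f ∘ ⇑p = f) := by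
  obtain ⟨q, hq⟩ := exists_perm_comp_eq f g h
  refine card_bij (fun p _ => p * q⁻¹) ?_ ?_ ?_
  · intro p hp
    simp only [mem_filter, mem_univ, true_and] at hp ⊢
    rw [Perm.coe_mul, ← Function.comp_assoc, hp, ← hq]
    funext i; simp
  · intro p _ p' _ h
    exact mul_right_cancel h
  · intro p hp
    simp only [mem_filter, mem_univ, true_and] at hp
    refine ⟨p * q, ?_, by simp⟩
    simp only [mem_filter, mem_univ, true_and]
    rw [Perm.coe_mul, ← Function.comp_assoc, hp, hq]

theorem card_ind_fiber (T : Finset (Fin n)) (b : ℕ) :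
    #{i | ind T i = b} = if b = 1 then #T else if b = 0 then n - #T else 0 := by
  split_ifs with h h
  · subst h; congr 1; ext i; simp [ind]
  · subst h
    have : ({i | ind T i = 0} : Finset (Fin n)) = Tᶜ := by ext i; simp [ind]
    rw [this, card_compl, Fintype.card_fin]
  · rw [card_eq_zero, filter_eq_empty_iff]
    intro i _
    simp only [ind]
    split_ifs <;> omega

/-- Burnside's count for the action of permutations on `c`-subsets. -/
theorem sum_card_inv_subsets {c : ℕ} (hc : c ≤ n) :
    ∑ p : Perm (Fin n), #((powersetCard c univ).filter
      fun T : Finset (Fin n) => ind T ∘ ⇑p = ind T) = Fintype.card (Perm (Fin n)) := by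
  obtain ⟨T₀, hT₀⟩ : ∃ T₀ : Finset (Fin n), #T₀ = c := by
    obtain ⟨T, _, hT⟩ := exists_subset_card_eq (s := (univ : Finset (Fin n))) (n := c)
      (by simpa using hc)
    exact ⟨T, hT⟩
  simp only [card_filter]
  rw [sum_comm]
  have h1 : ∀ T ∈ powersetCard c (univ : Finset (Fin n)),
      ∑ p : Perm (Fin n), (if ind T ∘ p = ind T then 1 else 0) =
      ∑ p : Perm (Fin n), (if ind T ∘ p = ind T₀ then 1 else 0) := by
    intro T hT
    rw [← card_filter, ← card_filter]
    refine (card_perm_comp_eq _ _ fun b => ?_).symm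
    rw [card_ind_fiber, card_ind_fiber, hT₀, (mem_powersetCard_univ.1 hT)]
  rw [sum_congr rfl h1, sum_comm]
  have h2 : ∀ p : Perm (Fin n), ∑ T ∈ powersetCard c (univ : Finset (Fin n)),
      (if ind T ∘ p = ind T₀ then 1 else 0) = 1 := by
    intro p
    simp only [ind_comp_eq_iff]
    rw [sum_ite_eq', if_pos]
    rw [mem_powersetCard_univ, card_map, hT₀]
  simp [h2]

open scoped Classical in
theorem cinner_chiF_self {H : Subgroup (PG n)} {f : Fin n → ℕ} (hf : ∀ i j, f i = f j)
    (h : IsSemi H ⊤ f) {c : ℕ} (hc : c ≤ n) (χ : H → ℂ)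
    (hχ : ∀ s p (hw : mk s p ∈ H), χ ⟨mk s p, hw⟩ = chiF c s p) : cinner χ χ = 1 := by
  have hS : (Fintype.card (⊤ : Subgroup (Fin n → ℤˣ)) : ℂ) ≠ 0 := by simp
  rw [h.cinner_eq _ _ (chiF c) (chiF c) hχ hχ (chiF_inv c), mul_assoc]
  have h1 : ∀ p : Perm (Fin n), ∑ s : (⊤ : Subgroup (Fin n → ℤˣ)), chiF c s p * chiF c s p =
      (Fintype.card (⊤ : Subgroup (Fin n → ℤˣ)) : ℂ) *
        #((powersetCard c univ).filter fun T : Finset (Fin n) => ind T ∘ ⇑p = ind T) := by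
    intro p
    have hsq : ((Perm.sign p : ℤ) : ℂ) * ((Perm.sign p : ℤ) : ℂ) = 1 := by
      rcases Int.units_eq_one_or (Perm.sign p) with h | h <;> simp [h]
    simp only [chiF, mul_mul_mul_comm _ _ ((Perm.sign p : ℤ) : ℂ), hsq, one_mul, sum_mul_sum,
      ← lam_add]
    simp only [sum_comm (γ := (⊤ : Subgroup (Fin n → ℤˣ))), sum_lam, lam_ind_add_eq_one_iff,
      oddSet_ind]
    rw [sum_congr rfl fun T hT => by rw [sum_ite_eq', if_pos hT]]
    rw [sum_const, nsmul_eq_mul, mul_comm]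
  have hst : stab f = univ := by
    ext p; simp only [mem_stab, mem_univ, iff_true]; funext i; exact hf _ _
  rw [sum_congr rfl fun p _ => h1 p, ← mul_sum, ← mul_assoc _ (Fintype.card _ : ℂ),
    inv_mul_cancel₀ hS, one_mul, hst, ← Nat.cast_sum, sum_card_inv_subsets hc, card_univ]
  exact inv_mul_cancel₀ (by simp)

open scoped Classical in
theorem cinner_chiF_sgn_ne_zero {H : Subgroup (PG n)} {S : Subgroup (Fin n → ℤˣ)} {f : Fin n → ℕ}
    (h : IsSemi H S f) {c : ℕ} (T₀ : Finset (Fin n)) (hT₀ : #T₀ = c)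
    (hT₀' : ∀ s ∈ S, lam (ind T₀ + 1) s = 1) (χ : H → ℂ)
    (hχ : ∀ s p (hw : mk s p ∈ H), χ ⟨mk s p, hw⟩ = chiF c s p) :
    cinner χ (resChar H sgnChar) ≠ 0 := by
  have hS : (Fintype.card S : ℂ) ≠ 0 := by simp
  rw [h.cinner_eq _ _ (chiF c)
    (fun (s : Fin n → ℤˣ) (p : Perm (Fin n)) => ((Perm.sign p : ℤ) : ℂ) * lam 1 s) hχ
    resChar_sgnChar_mk]
  swap
  · intro s p
    rw [Perm.sign_inv, lam_comp 1 s p⁻¹ rfl]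
  refine mul_ne_zero (mul_ne_zero (inv_ne_zero (card_perm_ne_zero f)) (inv_ne_zero hS)) ?_
  have h1 : ∀ p : Perm (Fin n), ∑ s : S,
      chiF c s p * (((Perm.sign p : ℤ) : ℂ) * lam 1 (s : Fin n → ℤˣ)) =
      ((∑ T ∈ (powersetCard c univ).filter fun T : Finset (Fin n) => ind T ∘ ⇑p = ind T,
        if ∀ s ∈ S, lam (ind T + 1) s = 1 then Fintype.card S else 0 : ℕ) : ℂ) := by
    intro p
    have hsq : ((Perm.sign p : ℤ) : ℂ) * ((Perm.sign p : ℤ) : ℂ) = 1 := by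
      rcases Int.units_eq_one_or (Perm.sign p) with h | h <;> simp [h]
    simp only [chiF, mul_mul_mul_comm _ _ ((Perm.sign p : ℤ) : ℂ), hsq, one_mul, sum_mul,
      ← lam_add]
    simp only [sum_comm (γ := S), sum_lam]
    push_cast
    rfl
  rw [sum_congr rfl fun p _ => h1 p, ← Nat.cast_sum, Nat.cast_ne_zero]
  refine (sum_pos' (fun _ _ => Nat.zero_le _) ⟨1, mem_stab.2 rfl,
    sum_pos' (fun _ _ => Nat.zero_le _) ⟨T₀, ?_, ?_⟩⟩).ne'
  · rw [mem_filter, mem_powersetCard_univ]; exact ⟨hT₀, rfl⟩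
  · rw [if_pos hT₀']; exact Fintype.card_pos

end Mult

section Frobenius

/-- Frobenius reciprocity. -/
theorem cinner_indChar {G : Type} [Group G] [Finite G] {H K : Subgroup G} (hHK : H ≤ K)
    (χ : K → ℂ) (hχ : ∀ x g, χ (x * g * x⁻¹) = χ g) (φ : H → ℂ) :
    cinner χ (indChar H K φ) = cinner (resSub H K χ) φ := by
  classical
  have := Fintype.ofFinite G
  have := Fintype.ofFinite K
  have := Fintype.ofFinite H
  simp only [cinner, indChar, finsum_eq_sum_of_fintype]
  have h1 : ∀ x : K, ∑ g : K, χ g * (if h : (x : G) * (g⁻¹ : K) * (x : G)⁻¹ ∈ H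
      then φ ⟨_, h⟩ else 0) = ∑ h : H, resSub H K χ h * φ h⁻¹ := by
    intro x
    have h2 : ∑ g : K, χ g * (if h : (x : G) * (g⁻¹ : K) * (x : G)⁻¹ ∈ H
        then φ ⟨_, h⟩ else 0) = ∑ g : K, χ g * (if h : ((g⁻¹ : K) : G) ∈ H
        then φ ⟨_, h⟩ else 0) := by
      refine Fintype.sum_equiv (MulAut.conj x).toEquiv _ _ fun g => ?_
      have h3 : (((MulAut.conj x).toEquiv g)⁻¹ : K) = x * g⁻¹ * x⁻¹ := by
        simp [MulAut.conj_apply, mul_assoc]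
      have h4 : χ ((MulAut.conj x).toEquiv g) = χ g := hχ x g
      rw [h4]
      congr 1
      simp only [h3]
      rfl
    rw [h2]
    symm
    refine sum_of_injOn (fun h : H => (⟨h, hHK h.2⟩ : K)) ?_ ?_ ?_ ?_
    · intro a _ b _ h
      exact Subtype.ext (congrArg (fun k : K => (k : G)) h)
    · simp [Set.MapsTo]
    · intro g _ hg
      rw [dif_neg, mul_zero]
      intro h
      refine hg ⟨⟨g, by simpa using h⟩, by simp, rfl⟩
    · intro h _
      rw [resSub, dif_pos (hHK h.2), dif_pos (by exact (h⁻¹).2)]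
      rfl
  simp only [mul_sum (s := (univ : Finset K))]
  rw [sum_comm]
  have h5 : ∀ x : K, ∑ g : K, (Nat.card K : ℂ)⁻¹ * (χ g * ((Nat.card H : ℂ)⁻¹ *
      (if h : (x : G) * (g⁻¹ : K) * (x : G)⁻¹ ∈ H then φ ⟨_, h⟩ else 0))) =
      (Nat.card K : ℂ)⁻¹ * ((Nat.card H : ℂ)⁻¹ * ∑ h : H, resSub H K χ h * φ h⁻¹) := by
    intro x
    rw [← h1 x, mul_sum, mul_sum]
    refine sum_congr rfl fun g _ => ?_
    ring
  rw [sum_congr rfl fun x _ => h5 x, sum_const, card_univ, nsmul_eq_mul, Nat.card_eq_fintype_card]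
  rw [mul_inv_cancel_left₀]
  simp

theorem IsChar.conj {G : Type} [Group G] {χ : G → ℂ} (h : IsChar χ) (x g : G) :
    χ (x * g * x⁻¹) = χ g := by
  obtain ⟨V, _, _, ρ, _, hρ⟩ := h
  rw [hρ, hρ, map_mul ρ, LinearMap.trace_mul_comm, ← map_mul ρ, ← mul_assoc,
    inv_mul_cancel, one_mul]

end Frobenius

section Rep
variable {n : ℕ}

/-- The monomial matrix by which a signed permutation acts on the span of the `c`-subsets. -/
def subsetMat (c : ℕ) (s : Fin n → ℤˣ) (p : Perm (Fin n)) :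
    Matrix {T : Finset (Fin n) // #T = c} {T : Finset (Fin n) // #T = c} ℂ :=
  Matrix.of fun T' T => if T'.1 = T.1.map p.toEmbedding then
    ((Perm.sign p : ℤ) : ℂ) * lam (ind T.1) s else 0

theorem lam_ind_map (T : Finset (Fin n)) (s : Fin n → ℤˣ) (q : Perm (Fin n)) :
    lam (ind (T.map q.toEmbedding)) s = lam (ind T) (fun i => s (q i)) := by
  rw [lam_apply, lam_apply, ← Equiv.prod_comp q]
  refine prod_congr rfl fun i _ => ?_
  simp [ind]

theorem subsetMat_mul (c : ℕ) (s t : Fin n → ℤˣ) (p q : Perm (Fin n)) :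
    subsetMat c s p * subsetMat c t q = subsetMat c (fun i => t i * s (q i)) (p * q) := by
  ext T'' T
  rw [Matrix.mul_apply, Finset.sum_eq_single ⟨T.1.map q.toEmbedding, by simpa using T.2⟩]
  · have h : T.1.map (p * q : Perm (Fin n)).toEmbedding =
        (T.1.map q.toEmbedding).map p.toEmbedding := by
      rw [Finset.map_map]; rfl
    simp only [subsetMat, Matrix.of_apply, if_true, h, lam_ind_map, Perm.sign_mul]
    split_ifs
    · rw [show (fun i => t i * s (q i)) = t * fun i => s (q i) from rfl, map_mul]
      push_cast
      ring
    · simp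
  · intro T' _ hT'
    rw [subsetMat, subsetMat, Matrix.of_apply, Matrix.of_apply, if_neg (c := T'.1 = _), mul_zero]
    exact fun h => hT' (Subtype.ext h)
  · simp

theorem subsetMat_one (c : ℕ) : subsetMat c (1 : Fin n → ℤˣ) 1 = 1 := by
  ext T' T
  have h : T.1.map (1 : Perm (Fin n)).toEmbedding = T.1 := Finset.map_refl
  simp only [subsetMat, Matrix.of_apply, h, Matrix.one_apply, Subtype.ext_iff, map_one]
  simp

theorem trace_subsetMat (c : ℕ) (s : Fin n → ℤˣ) (p : Perm (Fin n)) :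
    (subsetMat c s p).trace = chiF c s p := by
  rw [chiF, Matrix.trace, mul_sum, sum_filter,
    ← sum_subtype_of_mem (p := fun T : Finset (Fin n) => #T = c)
      (fun T => if ind T ∘ ⇑p = ind T then ((Perm.sign p : ℤ) : ℂ) * lam (ind T) s else 0)
      (fun T hT => mem_powersetCard_univ.1 hT)]
  refine sum_congr (by ext a; simp [a.2]) fun T _ => ?_
  simp only [Matrix.diag_apply, subsetMat, Matrix.of_apply, ind_comp_eq_iff]

theorem isChar_chiF {H : Subgroup (PG n)} {S : Subgroup (Fin n → ℤˣ)} {f : Fin n → ℕ}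
    (h : IsSemi H S f) (c : ℕ) (χ : H → ℂ)
    (hχ : ∀ s p (hw : mk s p ∈ H), χ ⟨mk s p, hw⟩ = chiF c s p) : IsChar χ := by
  have hex : ∀ g : H, ∃ s p, (g : PG n) = mk s p := fun g => by
    obtain ⟨s, -, p, -, hg⟩ := (h _).1 g.2
    exact ⟨s, p, hg⟩
  choose s p hsp using hex
  have hval : ∀ (g : H) t q, (g : PG n) = mk t q → s g = t ∧ p g = q := fun g t q hg =>
    mk_injective ((hsp g).symm.trans hg)
  let M : H →* Matrix {T : Finset (Fin n) // #T = c} {T : Finset (Fin n) // #T = c} ℂ :=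
    { toFun := fun g => subsetMat c (s g) (p g)
      map_one' := by
        obtain ⟨h1, h2⟩ := hval 1 1 1 (by rw [mk_one_one]; rfl)
        rw [h1, h2, subsetMat_one]
      map_mul' := fun a b => by
        obtain ⟨h1, h2⟩ := hval (a * b) (fun i => s b i * s a (p b i)) (p a * p b)
          (by rw [Subgroup.coe_mul, hsp a, hsp b, mk_mul])
        rw [h1, h2, subsetMat_mul] }
  refine ⟨{T : Finset (Fin n) // #T = c} → ℂ, inferInstance, inferInstance,
    (Matrix.toLinAlgEquiv' : _ ≃ₐ[ℂ] _).toAlgHom.toRingHom.toMonoidHom.comp M, inferInstance,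
    fun g => ?_⟩
  have h1 : χ g = chiF c (s g) (p g) := by
    rw [← hχ (s g) (p g) (hsp g ▸ g.2)]
    congr 1
    exact Subtype.ext (hsp g)
  rw [h1, ← trace_subsetMat]
  exact (Matrix.trace_toLin'_eq (subsetMat c (s g) (p g))).symm

end Rep

section Induced
variable {n : ℕ}

theorem epsOn_mk (T : Set (Fin n)) [DecidablePred (· ∈ T)] (s : Fin n → ℤˣ) (p : Perm (Fin n)) :
    epsOn T (mk s p) = lam (fun i => if i ∈ T then 1 else 0) s := by
  rw [epsOn, lam_apply, finprod_eq_prod_of_fintype]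
  refine prod_congr rfl fun i _ => ?_
  by_cases hi : i ∈ T <;> rcases Int.units_eq_one_or (s i) with h | h <;> simp [hi, h, mk_inl]

theorem conj_mk (s t : Fin n → ℤˣ) (p q : Perm (Fin n)) :
    mk t q * mk s p * (mk t q)⁻¹ =
      mk (fun i => t (q⁻¹ i) * s (q⁻¹ i) * t (p (q⁻¹ i))) (q * p * q⁻¹) := by
  rw [mk_inv, mk_mul, mk_mul]
  simp only [mul_assoc]

theorem lam_conj {e : Fin n → ℕ} {p q : Perm (Fin n)} (h : (e ∘ q) ∘ p = e ∘ q)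
    (s t : Fin n → ℤˣ) :
    lam e (fun i => t (q⁻¹ i) * s (q⁻¹ i) * t (p (q⁻¹ i))) = lam (e ∘ q) s := by
  have h1 : lam e (fun i => t (q⁻¹ i) * s (q⁻¹ i) * t (p (q⁻¹ i))) =
      lam (e ∘ q) (fun i => t i * s i * t (p i)) := by
    rw [lam_apply, lam_apply]
    exact (Fintype.prod_equiv q _ _ fun i => by simp).symm
  rw [h1, show (fun i => t i * s i * t (p i)) = t * s * fun i => t (p i) from rfl, map_mul, map_mul,
    lam_comp _ t p h, mul_right_comm, ← map_mul,
    show t * t = 1 from funext fun i => Int.units_mul_self (t i), map_one, one_mul]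

theorem sum_perm_comp {β : Type*} [DecidableEq β] [Fintype β] (f : Fin n → β)
    (Φ : (Fin n → β) → ℂ) :
    ∑ q : Perm (Fin n), Φ (f ∘ q) = #(univ.filter fun p : Perm (Fin n) => f ∘ ⇑p = f) *
      ∑ g : Fin n → β with ∀ b, #{i | g i = b} = #{i | f i = b}, Φ g := by
  rw [← sum_fiberwise' univ (fun q : Perm (Fin n) => f ∘ ⇑q), sum_filter, mul_sum]
  refine sum_congr rfl fun g _ => ?_
  rw [sum_const, nsmul_eq_mul]
  split_ifs with h
  · rw [card_perm_comp_eq f g fun b => (h b).symm]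
  · rw [card_eq_zero.2, Nat.cast_zero, zero_mul, mul_zero]
    rw [filter_eq_empty_iff]
    rintro q - rfl
    refine h fun b => ?_
    refine card_equiv q fun i => ?_
    simp

theorem indChar_blkSub {N : ℕ} (f : Fin n → Fin N) (r : ℕ) (s : Fin n → ℤˣ) (p : Perm (Fin n))
    (hw : mk s p ∈ BWn n) :
    indChar (blkSub n (fun i => (f i : ℕ)) fun _ => BTy.B) (BWn n)
      (resChar _ (epsOn {i | r ≤ (f i : ℕ)})) ⟨mk s p, hw⟩ =
    ∑ g : Fin n → Fin N with g ∘ ⇑p = g ∧ ∀ b, #{i | g i = b} = #{i | f i = b},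
      lam (fun i => if r ≤ (g i : ℕ) then 1 else 0) s := by
  classical
  have hB := isSemi_B (fun i => (f i : ℕ))
  have hS : (Fintype.card (⊤ : Subgroup (Fin n → ℤˣ)) : ℂ) ≠ 0 := by simp
  have hval : ∀ g : Fin n → Fin n, (fun i => (f i : ℕ)) ∘ g = (fun i => (f i : ℕ)) ↔ f ∘ g = f :=
    fun g => by simp [funext_iff, Fin.ext_iff]
  let Φ : (Fin n → Fin N) → ℂ := fun g =>
    if g ∘ ⇑p = g then lam (fun i => if r ≤ (g i : ℕ) then 1 else 0) s else 0
  have hW : IsSemi (BWn n) ⊤ fun _ => 0 := isSemi_B _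
  rw [indChar, hW.finsum_eq _ (fun _ q => Φ (f ∘ q))]
  · have h1 : stab (fun _ : Fin n => 0) = univ := by ext; simp [mem_stab]; rfl
    have h2 : stab (fun i => (f i : ℕ)) = univ.filter fun p : Perm (Fin n) => f ∘ ⇑p = f := by
      ext q; simp [mem_stab, hval]
    simp only [sum_const, card_univ, nsmul_eq_mul]
    rw [← mul_sum, h1, sum_perm_comp, hB.card_eq, ← h2]
    have := card_perm_ne_zero fun i => (f i : ℕ)
    field_simp
    rw [sum_filter, sum_filter]
    refine sum_congr rfl fun g _ => ?_
    simp only [Φ]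
    split_ifs <;> simp_all
  · intro t q hx
    have h3 : (mk t q * mk s p * (mk t q)⁻¹ ∈ blkSub n (fun i => (f i : ℕ)) fun _ => BTy.B) ↔
        (f ∘ ⇑q) ∘ ⇑p = f ∘ q := by
      rw [conj_mk, hB.mem, hval]
      simp only [Subgroup.mem_top, true_and]
      constructor
      · intro h
        funext i
        simpa using congrFun h (q i)
      · intro h
        funext i
        simpa using congrFun h (q⁻¹ i)
    simp only [Φ]
    split_ifs with h4 h5 h5
    · rw [resChar]
      simp only [conj_mk]
      rw [epsOn_mk, lam_conj]
      · rfl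
      · funext i
        have := congrFun h5 i
        simp only [Function.comp] at this ⊢
        simp [this]
    · exact absurd (h3.1 h4) h5
    · exact absurd (h3.2 h5) h4
    · rfl

end Induced

section Blocks

theorem blockOf_le_iff {N k i : ℕ} (c : ℕ → ℕ) (hk : k < N) :
    blockOf N c i ≤ k ↔ i < ∑ b ∈ range (k + 1), c b := by
  constructor
  · intro h
    by_contra! h'
    have : range (k + 1) ⊆ (range N).filter fun b => ∑ b' ∈ range (b + 1), c b' ≤ i := by
      intro b hb
      rw [mem_range] at hb
      rw [mem_filter, mem_range]
      exact ⟨by omega, (sum_le_sum_of_subset (range_subset_range.2 (by omega))).trans h'⟩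
    have := card_le_card this
    rw [card_range] at this
    exact absurd (this.trans h) (by omega)
  · intro h
    have : ((range N).filter fun b => ∑ b' ∈ range (b + 1), c b' ≤ i) ⊆ range k := by
      intro b hb
      rw [mem_filter, mem_range] at hb
      rw [mem_range]
      by_contra! hb'
      exact absurd (h.trans_le ((sum_le_sum_of_subset (range_subset_range.2
        (by omega : k + 1 ≤ b + 1))).trans hb.2)) (lt_irrefl _)
    simpa [blockOf] using card_le_card this

theorem blockOf_eq_iff {N k i : ℕ} (c : ℕ → ℕ) (hk : k < N) :
    blockOf N c i = k ↔ i ∈ Ico (∑ b ∈ range k, c b) (∑ b ∈ range (k + 1), c b) := by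
  rw [mem_Ico, le_antisymm_iff, blockOf_le_iff c hk, and_comm]
  refine and_congr_left fun _ => ?_
  cases k with
  | zero => simp
  | succ k =>
    rw [Nat.succ_le_iff, ← not_le, blockOf_le_iff c (by omega), not_lt]

theorem card_blockOf {n N k : ℕ} (c : ℕ → ℕ) (hk : k < N) (hc : ∑ b ∈ range N, c b = n) :
    #{i : Fin n | blockOf N c i = k} = c k := by
  have h1 : #{i : Fin n | blockOf N c i = k} =
      #(Ico (∑ b ∈ range k, c b) (∑ b ∈ range (k + 1), c b)) := by
    refine card_bij (fun i _ => i) ?_ ?_ ?_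
    · intro i hi
      rw [mem_filter] at hi
      exact (blockOf_eq_iff c hk).1 hi.2
    · intro i _ j _ h
      exact Fin.ext h
    · intro i hi
      have : i < n := (mem_Ico.1 hi).2.trans_le
        ((sum_le_sum_of_subset (range_subset_range.2 (by omega))).trans hc.le)
      exact ⟨⟨i, this⟩, by rw [mem_filter]; exact ⟨mem_univ _, (blockOf_eq_iff c hk).2 hi⟩, rfl⟩
  rw [h1, Nat.card_Ico, sum_range_succ, Nat.add_sub_cancel_left]

theorem blockOf_lt {n N : ℕ} (c : ℕ → ℕ) (hc : ∑ b ∈ range N, c b = n) (i : Fin n) :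
    blockOf N c i < N := by
  cases N with
  | zero => simp at hc; exact absurd i.2 (by omega)
  | succ N => rw [Nat.lt_succ_iff, blockOf_le_iff c (by omega), hc]; exact i.2

theorem card_sum_fibers {n r s : ℕ} (g : Fin n → Fin r ⊕ Fin s) :
    ∑ i, #{x | g x = Sum.inl i} + ∑ j, #{x | g x = Sum.inr j} = n := by
  have := card_eq_sum_card_fiberwise (s := (univ : Finset (Fin n))) (t := univ)
    (f := g) (fun _ _ => mem_univ _)
  rw [Fintype.sum_sum_type, card_univ, Fintype.card_fin] at this
  exact this.symm

theorem indPiece_mk {n r s : ℕ} (c : Fin r → ℤ) (d : Fin s → ℤ) (t : Fin n → ℤˣ)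
    (p : Perm (Fin n)) (hw : mk t p ∈ BWn n) :
    indPiece n r s c d ⟨mk t p, hw⟩ =
      ∑ g : Fin n → Fin r ⊕ Fin s with g ∘ ⇑p = g ∧ (∀ i, (#{x | g x = Sum.inl i} : ℤ) = c i) ∧
        ∀ j, (#{x | g x = Sum.inr j} : ℤ) = d j,
        lam (fun x => if (g x).isRight then 1 else 0) t := by
  rw [indPiece]
  split_ifs with h
  · obtain ⟨hc, hd, hsum⟩ := h
    lift c to Fin r → ℕ using hc
    lift d to Fin s → ℕ using hd
    set cs : ℕ → ℕ := fun b => if hb : b < r then ((c ⟨b, hb⟩ : ℤ)).toNat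
      else if hb' : b - r < s then ((d ⟨b - r, hb'⟩ : ℤ)).toNat else 0 with hcs
    have hl : ∀ i : Fin r, cs (finSumFinEquiv (Sum.inl i : Fin r ⊕ Fin s)) = c i := by
      intro i; simp [hcs]
    have hr : ∀ j : Fin s, cs (finSumFinEquiv (Sum.inr j : Fin r ⊕ Fin s)) = d j := by
      intro j; simp [hcs]
    have hN : ∑ b ∈ range (r + s), cs b = n := by
      rw [Finset.sum_range, ← Equiv.sum_comp finSumFinEquiv, Fintype.sum_sum_type]
      simp only [hl, hr]
      have h : (∑ i, (c i : ℤ)) + ∑ j, (d j : ℤ) = n := hsum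
      exact_mod_cast h
    let f : Fin n → Fin (r + s) := fun i => ⟨blockOf (r + s) cs i, blockOf_lt cs hN i⟩
    refine (indChar_blkSub f r t p hw).trans ?_
    have hf : ∀ b : Fin (r + s), #{i | f i = b} = cs b := by
      intro b
      rw [← card_blockOf cs b.2 hN]
      simp only [f, Fin.ext_iff]
    symm
    refine sum_equiv (Equiv.arrowCongr (Equiv.refl _) finSumFinEquiv) ?_ ?_
    · intro g
      simp only [mem_filter, mem_univ, true_and, hf]
      refine and_congr ?_ ?_
      · simp [funext_iff]
      · rw [← finSumFinEquiv.forall_congr_right, Sum.forall]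
        simp only [hl, hr, Nat.cast_inj, arrowCongr_apply, Function.comp, refl_symm, refl_apply,
          EmbeddingLike.apply_eq_iff_eq]
    · intro g _
      congr 2
      funext i
      rcases h : g i with a | a <;> simp [h]
  · symm
    rw [filter_eq_empty_iff.2, sum_empty]
    · rfl
    rintro g - ⟨-, hc, hd⟩
    refine h ⟨fun i => by simp [← hc], fun j => by simp [← hd], ?_⟩
    simp only [← hc, ← hd]
    exact_mod_cast card_sum_fibers g

end Blocks

section Restriction
variable {n : ℕ}

/-- The finite sets of points stable under `p`. -/
def invSets (p : Perm (Fin n)) : Finset (Finset (Fin n)) :=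
  univ.filter fun T : Finset (Fin n) => ∀ x, p x ∈ T ↔ x ∈ T

theorem mem_invSets {p : Perm (Fin n)} {T : Finset (Fin n)} :
    T ∈ invSets p ↔ ∀ x, p x ∈ T ↔ x ∈ T := by
  simp [invSets]

theorem mem_invSets_iff_ind {p : Perm (Fin n)} {T : Finset (Fin n)} :
    T ∈ invSets p ↔ ind T ∘ ⇑p = ind T := by
  rw [mem_invSets, funext_iff]
  refine forall_congr' fun x => ?_
  simp only [ind, Function.comp]
  split_ifs <;> simp_all

/-- The permutation acting as `p` on the stable set `T` and trivially elsewhere. -/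
def restr (p : Perm (Fin n)) (T : Finset (Fin n)) : Perm (Fin n) :=
  if h : ∀ x, p x ∈ T ↔ x ∈ T then Perm.ofSubtype (p.subtypePerm h) else 1

theorem restr_apply {p : Perm (Fin n)} {T : Finset (Fin n)} (h : T ∈ invSets p) (x : Fin n) :
    restr p T x = if x ∈ T then p x else x := by
  rw [mem_invSets] at h
  rw [restr, dif_pos h]
  split_ifs with hx
  · rw [Perm.ofSubtype_apply_of_mem _ hx]; rfl
  · exact Perm.ofSubtype_apply_of_not_mem _ hx

/-- The sign of the restriction of `p` to `T`. -/
def sg (p : Perm (Fin n)) (T : Finset (Fin n)) : ℤ := Perm.sign (restr p T)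

theorem union_mem_invSets {p : Perm (Fin n)} {T U : Finset (Fin n)} (hT : T ∈ invSets p)
    (hU : U ∈ invSets p) : T ∪ U ∈ invSets p := by
  simp_all [mem_invSets]

theorem sdiff_mem_invSets {p : Perm (Fin n)} {T U : Finset (Fin n)} (hT : T ∈ invSets p)
    (hU : U ∈ invSets p) : T \ U ∈ invSets p := by
  simp_all [mem_invSets]

theorem compl_mem_invSets {p : Perm (Fin n)} {T : Finset (Fin n)} (hT : T ∈ invSets p) :
    Tᶜ ∈ invSets p := by
  simp_all [mem_invSets]

theorem sg_union {p : Perm (Fin n)} {T U : Finset (Fin n)} (hT : T ∈ invSets p)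
    (hU : U ∈ invSets p) (h : Disjoint T U) : sg p (T ∪ U) = sg p T * sg p U := by
  have : restr p (T ∪ U) = restr p T * restr p U := by
    ext x
    have h1 := mem_invSets.1 hU x
    have h2 : x ∈ U → x ∉ T := fun hx hx' => disjoint_left.1 h hx' hx
    have h3 : p x ∈ U → p x ∉ T := fun hx hx' => disjoint_left.1 h hx' hx
    rw [Perm.mul_apply, restr_apply (union_mem_invSets hT hU), restr_apply hU, restr_apply hT]
    simp only [mem_union]
    by_cases hx : x ∈ U <;> simp_all
  rw [sg, this, Perm.sign_mul, Units.val_mul]; rfl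

theorem sg_univ (p : Perm (Fin n)) : sg p univ = Perm.sign p := by
  rw [sg]; congr 2; ext x
  rw [restr_apply (by simp [mem_invSets])]; simp

theorem sg_empty (p : Perm (Fin n)) : sg p ∅ = 1 := by
  have : restr p ∅ = 1 := by
    ext x
    rw [restr_apply (by simp [mem_invSets])]; simp
  rw [sg, this]; simp

theorem sg_mul_sg_compl {p : Perm (Fin n)} {T : Finset (Fin n)} (hT : T ∈ invSets p) :
    sg p T * sg p Tᶜ = Perm.sign p := by
  rw [← sg_union hT (compl_mem_invSets hT) disjoint_compl_right, union_compl, sg_univ]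

open scoped Classical in
/-- The cycle of `p` through `x`, as a set. -/
def orb (p : Perm (Fin n)) (x : Fin n) : Finset (Fin n) := univ.filter fun y => p.SameCycle x y

theorem mem_orb {p : Perm (Fin n)} {x y : Fin n} : y ∈ orb p x ↔ p.SameCycle x y := by
  simp [orb]

theorem orb_mem_invSets (p : Perm (Fin n)) (x : Fin n) : orb p x ∈ invSets p := by
  simp [mem_invSets, mem_orb]

theorem sg_orb (p : Perm (Fin n)) (x : Fin n) : sg p (orb p x) = -(-1) ^ #(orb p x) := by
  have h1 : restr p (orb p x) = p.cycleOf x := by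
    ext y
    rw [restr_apply (orb_mem_invSets p x), Perm.cycleOf_apply]
    simp only [mem_orb]
  rw [sg, h1]
  by_cases hx : p x = x
  · have : orb p x = {x} := by
      ext y
      rw [mem_orb, mem_singleton]
      exact ⟨fun h => (h.eq_of_left hx).symm, fun h => h ▸ Perm.SameCycle.refl _ _⟩
    rw [(Perm.cycleOf_eq_one_iff p).2 hx, this]
    simp
  · have : (p.cycleOf x).support = orb p x := by
      ext y
      rw [Perm.mem_support_cycleOf_iff' hx, mem_orb]
    rw [(Perm.isCycle_cycleOf p hx).sign, this]
    simp

theorem subset_or_disjoint_orb {p : Perm (Fin n)} {T : Finset (Fin n)} (hT : T ∈ invSets p)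
    (x : Fin n) : orb p x ⊆ T ∨ Disjoint T (orb p x) := by
  rw [mem_invSets] at hT
  have key : ∀ (y : Fin n) (k : ℤ), (p ^ k) y ∈ T ↔ y ∈ T := by
    intro y k
    induction k with
    | zero => simp
    | succ k ih => rw [← ih, add_comm, zpow_add, Perm.mul_apply, zpow_one, hT]
    | pred k ih => rw [← ih, sub_eq_neg_add, zpow_add, Perm.mul_apply, zpow_neg_one, ← hT]; simp
  by_cases hx : x ∈ T
  · left
    intro y hy
    obtain ⟨k, rfl⟩ := mem_orb.1 hy
    exact (key x k).2 hx
  · right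
    rw [disjoint_right]
    intro y hy
    obtain ⟨k, rfl⟩ := mem_orb.1 hy
    rwa [key x k]

theorem sum_sg_eq_zero {p : Perm (Fin n)} {X : Finset (Fin n)} (hX : X ∈ invSets p)
    (hne : X.Nonempty) : ∑ U ∈ invSets p with U ⊆ X, (-1) ^ #U * sg p U = 0 := by
  obtain ⟨x, hx⟩ := hne
  have hC := orb_mem_invSets p x
  have hxC : x ∈ orb p x := mem_orb.2 (Perm.SameCycle.refl _ _)
  have hCX : orb p x ⊆ X := (subset_or_disjoint_orb hX x).resolve_right fun h =>
    disjoint_left.1 h hx hxC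
  have key : ∀ U ∈ invSets p, Disjoint U (orb p x) →
      (-1) ^ #U * sg p U + (-1) ^ #(U ∪ orb p x) * sg p (U ∪ orb p x) = 0 := by
    intro U hU hd
    rw [sg_union hU hC hd, card_union_of_disjoint hd, sg_orb, pow_add]
    have : ((-1 : ℤ) ^ #(orb p x)) * (-1) ^ #(orb p x) = 1 := by
      rw [← mul_pow]; simp
    linear_combination (-(-1) ^ #U * sg p U) * this
  refine sum_involution (fun U _ => if Disjoint U (orb p x) then U ∪ orb p x else U \ orb p x)
    ?_ ?_ ?_ ?_
  · intro U hU
    have hU' := (mem_filter.1 hU).1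
    split_ifs with h
    · exact key U hU' h
    · have hs : orb p x ⊆ U := (subset_or_disjoint_orb hU' x).resolve_right h
      have := key _ (sdiff_mem_invSets hU' hC) sdiff_disjoint
      rw [sdiff_union_of_subset hs] at this
      rw [add_comm, this]
  · intro U hU _ h
    split_ifs at h with hd
    · exact disjoint_left.1 hd (h ▸ mem_union_right _ hxC) hxC
    · have hs : orb p x ⊆ U := (subset_or_disjoint_orb (mem_filter.1 hU).1 x).resolve_right hd
      have h1 := hs hxC
      rw [← h] at h1
      exact (mem_sdiff.1 h1).2 hxC
  · intro U hU
    obtain ⟨hU, hUX⟩ := mem_filter.1 hU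
    rw [mem_filter]
    split_ifs with hd
    · exact ⟨union_mem_invSets hU hC, union_subset hUX hCX⟩
    · exact ⟨sdiff_mem_invSets hU hC, sdiff_subset.trans hUX⟩
  · intro U hU
    by_cases hd : Disjoint U (orb p x)
    · rw [if_pos hd, if_neg, union_sdiff_cancel_right hd]
      intro h
      exact disjoint_left.1 h (mem_union_right _ hxC) hxC
    · have hs : orb p x ⊆ U := (subset_or_disjoint_orb (mem_filter.1 hU).1 x).resolve_right hd
      rw [if_neg hd, if_pos sdiff_disjoint, sdiff_union_of_subset hs]

end Restriction

section JacobiTrudi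
variable {n : ℕ} {A : Type*} [CommRing A]

/-- The complete symmetric function analogue attached to a permutation. -/
def hp (p : Perm (Fin n)) (v : Fin n → A) (k : ℤ) : A :=
  ∑ T ∈ invSets p with (#T : ℤ) = k, ∏ i ∈ T, v i

/-- The elementary symmetric function analogue attached to a permutation. -/
def ep (p : Perm (Fin n)) (v : Fin n → A) (k : ℕ) : A :=
  ∑ T ∈ invSets p with #T = k, (sg p T : A) * ∏ i ∈ T, v i

theorem hp_neg (p : Perm (Fin n)) (v : Fin n → A) {k : ℤ} (hk : k < 0) : hp p v k = 0 := by
  rw [hp, filter_eq_empty_iff.2, sum_empty]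
  intro T _ h
  omega

theorem hp_zero (p : Perm (Fin n)) (v : Fin n → A) : hp p v 0 = 1 := by
  have : ((invSets p).filter fun T => (#T : ℤ) = 0) = {∅} := by
    ext T
    simp only [mem_filter, Nat.cast_eq_zero, card_eq_zero, mem_singleton, and_iff_right_iff_imp]
    rintro rfl
    simp [mem_invSets]
  rw [hp, this]; simp

theorem ep_zero (p : Perm (Fin n)) (v : Fin n → A) : ep p v 0 = 1 := by
  have : ((invSets p).filter fun T => #T = 0) = {∅} := by
    ext T
    simp only [mem_filter, card_eq_zero, mem_singleton, and_iff_right_iff_imp]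
    rintro rfl
    simp [mem_invSets]
  rw [ep, this]; simp [sg_empty]

theorem sum_ep_mul_hp (p : Perm (Fin n)) {v : Fin n → A} (hv : ∀ i, v i * v i = 0) (k : ℕ) :
    ∑ j ∈ range (k + 1), (-1) ^ j * ep p v j * hp p v (k - j : ℤ) = if k = 0 then 1 else 0 := by
  have h1 : ∀ j ∈ range (k + 1), (-1) ^ j * ep p v j * hp p v (k - j : ℤ) =
      ∑ U ∈ invSets p, ∑ T ∈ invSets p, if #U = j ∧ #U + #T = k then
        (-1) ^ #U * (sg p U : A) * ((∏ i ∈ U, v i) * ∏ i ∈ T, v i) else 0 := by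
    intro j _
    rw [ep, hp, sum_filter, sum_filter, mul_assoc, sum_mul_sum, mul_sum]
    refine sum_congr rfl fun U _ => ?_
    rw [mul_sum]
    refine sum_congr rfl fun T _ => ?_
    by_cases hU : #U = j
    · subst hU
      by_cases hT : (#T : ℤ) = k - #U
      · rw [if_pos rfl, if_pos hT, if_pos ⟨rfl, by omega⟩]; ring
      · rw [if_neg hT, if_neg (c := _ ∧ _) (fun h => hT (by omega)), mul_zero, mul_zero]
    · simp [hU]
  rw [sum_congr rfl h1, sum_comm]
  have h2 : ∀ U ∈ invSets p, ∑ j ∈ range (k + 1), ∑ T ∈ invSets p,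
      (if #U = j ∧ #U + #T = k then
        (-1) ^ #U * (sg p U : A) * ((∏ i ∈ U, v i) * ∏ i ∈ T, v i) else 0) =
      ∑ X ∈ invSets p with #X = k, if U ⊆ X then
        ((-1) ^ #U * sg p U : ℤ) * ∏ i ∈ X, v i else 0 := by
    intro U hU
    rw [sum_comm]
    have h3 : ∀ T ∈ invSets p, ∑ j ∈ range (k + 1), (if #U = j ∧ #U + #T = k then
        (-1) ^ #U * (sg p U : A) * ((∏ i ∈ U, v i) * ∏ i ∈ T, v i) else 0) =
        if Disjoint U T ∧ #(U ∪ T) = k then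
          ((-1) ^ #U * sg p U : ℤ) * ∏ i ∈ U ∪ T, v i else 0 := by
      intro T _
      by_cases hd : Disjoint U T
      · rw [card_union_of_disjoint hd, prod_union hd]
        by_cases hk : #U + #T = k
        · simp only [hk, and_true, hd, if_true]
          rw [sum_ite_eq, if_pos (mem_range.2 (by omega))]
          push_cast; rfl
        · simp [hk]
      · obtain ⟨x, hxU, hxT⟩ := not_disjoint_iff.1 hd
        have : (∏ i ∈ U, v i) * ∏ i ∈ T, v i = 0 := by
          rw [← mul_prod_erase _ _ hxU, ← mul_prod_erase _ _ hxT, mul_mul_mul_comm, hv, zero_mul]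
        simp [this, hd]
    rw [sum_congr rfl h3, ← sum_filter, ← sum_filter, filter_filter]
    refine sum_bij' (fun T _ => U ∪ T) (fun X _ => X \ U) ?_ ?_ ?_ ?_ ?_
    · intro T hT
      obtain ⟨hT, hd, hk⟩ := mem_filter.1 hT
      exact mem_filter.2 ⟨union_mem_invSets hU hT, hk, subset_union_left⟩
    · intro X hX
      obtain ⟨hX, hk, hUX⟩ := mem_filter.1 hX
      refine mem_filter.2 ⟨sdiff_mem_invSets hX hU, disjoint_sdiff, ?_⟩
      rw [union_sdiff_of_subset hUX, hk]
    · intro T hT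
      exact union_sdiff_cancel_left (mem_filter.1 hT).2.1
    · intro X hX
      exact union_sdiff_of_subset (mem_filter.1 hX).2.2
    · intro T _; rfl
  rw [sum_congr rfl h2, sum_comm]
  have h4 : ∀ X ∈ (invSets p).filter (fun X => #X = k), (∑ U ∈ invSets p, if U ⊆ X then
      (((-1) ^ #U * sg p U : ℤ) : A) * ∏ i ∈ X, v i else 0) = if X = ∅ then 1 else 0 := by
    intro X hX
    rw [← sum_filter, ← sum_mul, ← Int.cast_sum]
    split_ifs with h
    · subst h
      simp only [subset_empty]
      rw [sum_filter, sum_ite_eq', if_pos (by simp [mem_invSets])]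
      simp [sg_empty]
    · rw [sum_sg_eq_zero (mem_filter.1 hX).1 (nonempty_iff_ne_empty.2 h)]
      simp
  rw [sum_congr rfl h4, sum_ite_eq']
  by_cases hk : k = 0
  · simp [hk, mem_invSets]
  · rw [if_neg, if_neg hk]
    simpa using fun _ => Ne.symm hk

end JacobiTrudi

section Determinant
variable {n : ℕ} {A : Type*} [CommRing A]

theorem sum_ep_mul_hp_zero (p : Perm (Fin n)) {v : Fin n → A} (hv : ∀ i, v i * v i = 0) (k : ℕ) :
    ∑ l ∈ range (k + 1), (-1) ^ l * ep p v l * hp p v (1 + k - l : ℤ) =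
      (-1) ^ k * ep p v (k + 1) := by
  have h := sum_ep_mul_hp p hv (k + 1)
  rw [sum_range_succ, if_neg (by omega)] at h
  push_cast at h
  rw [sub_self, hp_zero] at h
  have h1 : ∀ l : ℕ, (1 + k - l : ℤ) = k + 1 - l := fun l => by ring
  simp only [h1]
  linear_combination h

theorem sum_ep_mul_hp_succ (p : Perm (Fin n)) {v : Fin n → A} (hv : ∀ i, v i * v i = 0)
    (i k : ℕ) :
    ∑ l ∈ range (k + 1), (-1) ^ l * ep p v l * hp p v (k - i - l : ℤ) = if i = k then 1 else 0 := by
  rcases lt_or_ge k i with h | h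
  · rw [if_neg (by omega)]
    refine sum_eq_zero fun l _ => ?_
    rw [hp_neg _ _ (by omega), mul_zero]
  · obtain ⟨K, rfl⟩ := Nat.exists_eq_add_of_le h
    have h1 := sum_ep_mul_hp p hv K
    rw [sum_subset (range_subset_range.2 (by omega : K + 1 ≤ i + K + 1))] at h1
    · simpa using h1
    · intro l _ hl
      rw [mem_range] at hl
      rw [hp_neg _ _ (by omega), mul_zero]

theorem det_hp (p : Perm (Fin n)) {v : Fin n → A} (hv : ∀ i, v i * v i = 0) (c : ℕ) :
    (Matrix.of fun i j : Fin c => hp p v (1 - (i : ℕ) + (j : ℕ) : ℤ)).det = ep p v c := by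
  cases c with
  | zero => rw [Matrix.det_isEmpty, ep_zero]
  | succ m =>
    set M : Matrix (Fin (m + 1)) (Fin (m + 1)) A :=
      Matrix.of fun i j => hp p v (1 - (i : ℕ) + (j : ℕ) : ℤ) with hM
    let U : Matrix (Fin (m + 1)) (Fin (m + 1)) A :=
      Matrix.of fun j k => if j ≤ k then (-1) ^ ((k : ℕ) - j) * ep p v (k - j) else 0
    have hU : U.det = 1 := by
      rw [Matrix.det_of_isUpperTriangular]
      · refine prod_eq_one fun i _ => ?_
        simp [U, ep_zero]
      · intro i j hij
        simp only [U, Matrix.of_apply]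
        exact if_neg (not_le.2 hij)
    have hMU : ∀ i k, (M * U) i k =
        ∑ l ∈ range (k + 1), (-1) ^ l * ep p v l * hp p v (1 - (i : ℕ) + (k : ℕ) - l : ℤ) := by
      intro i k
      rw [Matrix.mul_apply, ← sum_range_reflect]
      symm
      refine sum_of_injOn (fun l => if h : l < m + 1 then ⟨l, h⟩ else 0) ?_ ?_ ?_ ?_
      · intro a ha b hb hab
        have ha' : a < m + 1 := (mem_range.1 ha).trans_le (by omega)
        have hb' : b < m + 1 := (mem_range.1 hb).trans_le (by omega)
        simpa [ha', hb'] using hab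
      · simp [Set.MapsTo]
      · intro j _ hj
        have : ¬ j ≤ k := fun h => hj ⟨j, by simpa using Nat.lt_succ_of_le h, dif_pos j.2⟩
        simp [U, this]
      · intro l hl
        have hl' : l < m + 1 := (mem_range.1 hl).trans_le (by omega)
        have hlk : l ≤ k := Nat.lt_succ_iff.1 (mem_range.1 hl)
        have hle : (⟨l, hl'⟩ : Fin (m + 1)) ≤ k := hlk
        simp only [hl', dif_pos, U, hM, Matrix.of_apply, hle, if_true]
        have h1 : (k : ℕ) + 1 - 1 - l = k - l := by omega
        have h2 : (1 - (i : ℕ) + (k : ℕ) - ((k : ℕ) - l : ℕ) : ℤ) = 1 - (i : ℕ) + l := by omega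
        rw [h1, h2, mul_comm]
    have hdet : M.det = (M * U).det := by rw [Matrix.det_mul, hU, mul_one]
    rw [hdet, Matrix.det_succ_column _ (Fin.last m), Fin.sum_univ_succ]
    rw [sum_eq_zero, add_zero]
    · have h0 : (M * U) 0 (Fin.last m) = (-1) ^ m * ep p v (m + 1) := by
        rw [hMU, ← sum_ep_mul_hp_zero p hv]
        simp
      have h1 : (M * U).submatrix (Fin.succAbove 0) (Fin.last m).succAbove = 1 := by
        ext i k
        rw [Matrix.submatrix_apply, hMU, Fin.zero_succAbove, Fin.succAbove_last, Matrix.one_apply]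
        have := sum_ep_mul_hp_succ p hv i k
        simp only [Fin.ext_iff, ← this, Fin.val_castSucc, Fin.val_succ]
        refine sum_congr rfl fun l _ => ?_
        congr 2
        push_cast
        ring
      rw [h0, h1, Matrix.det_one, mul_one]
      simp only [Fin.val_zero, Fin.val_last, zero_add]
      rw [← mul_assoc, ← mul_pow]
      simp
    · intro i _
      have : (M * U) i.succ (Fin.last m) = 0 := by
        rw [hMU]
        have h2 := sum_ep_mul_hp_succ p hv i m
        rw [if_neg (by omega)] at h2
        rw [← h2, Fin.val_last]
        refine sum_congr rfl fun l _ => ?_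
        congr 2
        push_cast [Fin.val_succ]
        ring
      rw [this]; ring

theorem det_hp_zero_row (p : Perm (Fin n)) {v : Fin n → A} (hv : ∀ i, v i * v i = 0) (c : ℕ) :
    (Matrix.of fun i j : Fin (c + 1) =>
      hp p v ((if (i : ℕ) < c then 1 else 0) - (i : ℕ) + (j : ℕ) : ℤ)).det = ep p v c := by
  rw [Matrix.det_succ_row _ (Fin.last c), Fin.sum_univ_castSucc, sum_eq_zero, zero_add,
    ← det_hp p hv c]
  · simp only [Fin.succAbove_last, Fin.val_last, Matrix.of_apply, lt_irrefl, if_false]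
    rw [show ((0 : ℤ) - (c : ℕ) + (c : ℕ)) = 0 by ring, hp_zero, mul_one, ← two_mul, pow_mul]
    simp only [neg_one_sq, one_pow, one_mul]
    congr 1
    ext i j
    simp
  · intro j _
    simp only [Fin.val_last, Matrix.of_apply, lt_irrefl, if_false, Fin.val_castSucc]
    rw [hp_neg _ _ (by omega)]; ring

end Determinant

section Coefficient
variable {n : ℕ}

open MvPolynomial

theorem coeff_prod_family {B : Type*} [Fintype B] [DecidableEq B] (w : B → Fin n → ℂ)
    (T : B → Finset (Fin n)) :
    coeff (Finsupp.equivFunOnFinite.symm fun _ => 1)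
      (∏ b, ∏ i ∈ T b, (C (w b i) * X i : MvPolynomial (Fin n) ℂ)) =
      if ∀ i, #{b | i ∈ T b} = 1 then ∏ b, ∏ i ∈ T b, w b i else 0 := by
  have h : ∏ b, ∏ i ∈ T b, (C (w b i) * X i : MvPolynomial (Fin n) ℂ) =
      monomial (Finsupp.equivFunOnFinite.symm fun i => #{b | i ∈ T b})
        (∏ b, ∏ i ∈ T b, w b i) := by
    rw [monomial_eq, Finsupp.prod_fintype _ _ (by simp)]
    simp only [prod_mul_distrib, map_prod]
    congr 1
    simp only [Finsupp.equivFunOnFinite_symm_apply_apply]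
    rw [prod_comm' (t' := univ) (s' := fun i => univ.filter fun b => i ∈ T b) (by simp)]
    simp
  rw [h, coeff_monomial]
  congr 1
  rw [EmbeddingLike.apply_eq_iff_eq, funext_iff]

/-- The coefficient of the product of all variables vanishes on the ideal generated by the
squares of the variables. -/
theorem coeff_eq_of_sub_mem {P Q : MvPolynomial (Fin n) ℂ}
    (h : P - Q ∈ Ideal.span (Set.range fun i : Fin n => (X i * X i : MvPolynomial (Fin n) ℂ))) :
    coeff (Finsupp.equivFunOnFinite.symm fun _ => 1) P =
      coeff (Finsupp.equivFunOnFinite.symm fun _ => 1) Q := by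
  obtain ⟨a, ha⟩ := Ideal.mem_span_range_iff_exists_fun.1 h
  rw [← sub_eq_zero, ← coeff_sub, ← ha, coeff_sum]
  refine sum_eq_zero fun i _ => ?_
  rw [← mul_assoc, coeff_mul_X', coeff_mul_X']
  simp

theorem prod_hp {p : Perm (Fin n)} {B : Type*} [Fintype B] [DecidableEq B] (w : B → Fin n → ℂ)
    (k : B → ℤ) :
    coeff (Finsupp.equivFunOnFinite.symm fun _ => 1)
      (∏ b, hp p (fun i => (C (w b i) * X i : MvPolynomial (Fin n) ℂ)) (k b)) =
      ∑ g : Fin n → B with g ∘ ⇑p = g ∧ ∀ b, (#{i | g i = b} : ℤ) = k b, ∏ i, w (g i) i := by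
  simp only [hp]
  rw [prod_univ_sum, coeff_sum]
  simp only [coeff_prod_family]
  rw [← sum_filter]
  symm
  refine sum_bij (fun g _ b => univ.filter fun i => g i = b) ?_ ?_ ?_ ?_
  · intro g hg
    obtain ⟨-, hp, hk⟩ := mem_filter.1 hg
    rw [mem_filter, Fintype.mem_piFinset]
    refine ⟨fun b => mem_filter.2 ⟨?_, hk b⟩, fun i => ?_⟩
    · rw [mem_invSets]
      intro x
      simp [show g (p x) = g x from congrFun hp x]
    · rw [card_eq_one]
      exact ⟨g i, by ext; simp [eq_comm]⟩
  · intro g _ g' _ h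
    funext i
    have := congrFun h (g' i)
    simpa using (Finset.ext_iff.1 this i)
  · intro T hT
    rw [mem_filter, Fintype.mem_piFinset] at hT
    obtain ⟨hT, h1⟩ := hT
    have h2 : ∀ i, ∃ b, ∀ b', i ∈ T b' ↔ b' = b := fun i => by
      obtain ⟨b, hb⟩ := card_eq_one.1 (h1 i)
      exact ⟨b, fun b' => by simpa using Finset.ext_iff.1 hb b'⟩
    choose g hg using h2
    have hT' : T = fun b => univ.filter fun i => g i = b := by
      funext b; ext i; simp [hg, eq_comm]
    refine ⟨g, mem_filter.2 ⟨mem_univ _, ?_, fun b => ?_⟩, hT'.symm⟩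
    · funext x
      have := mem_invSets.1 (mem_filter.1 (hT (g x))).1 x
      exact ((hg _ _).1 (this.2 ((hg _ _).2 rfl))).symm
    · rw [← (mem_filter.1 (hT b)).2, hT']
  · intro g _
    rw [← prod_fiberwise univ g]
    refine prod_congr rfl fun b _ => prod_congr rfl fun i hi => ?_
    rw [(mem_filter.1 hi).2]

theorem prod_ep {p : Perm (Fin n)} (w : Bool → Fin n → ℂ) (k : Bool → ℕ) :
    coeff (Finsupp.equivFunOnFinite.symm fun _ => 1)
      (∏ b, ep p (fun i => (C (w b i) * X i : MvPolynomial (Fin n) ℂ)) (k b)) =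
      ((Perm.sign p : ℤ) : ℂ) * ∑ T ∈ invSets p with #T = k true ∧ #Tᶜ = k false,
        ∏ i, if i ∈ T then w true i else w false i := by
  simp only [ep]
  rw [prod_univ_sum, coeff_sum]
  have h1 : ∀ T : Bool → Finset (Fin n), coeff (Finsupp.equivFunOnFinite.symm fun _ => 1)
      (∏ b, (((sg p (T b) : ℤ) : MvPolynomial (Fin n) ℂ) * ∏ i ∈ T b, (C (w b i) * X i))) =
        if ∀ i, #{b | i ∈ T b} = 1 then
          ((∏ b, sg p (T b) : ℤ) : ℂ) * ∏ b, ∏ i ∈ T b, w b i else 0 := by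
    intro T
    rw [prod_mul_distrib, ← Int.cast_prod, ← map_intCast (C : ℂ →+* MvPolynomial (Fin n) ℂ),
      coeff_C_mul, coeff_prod_family, mul_ite, mul_zero]
  have h2 : ∀ (T : Finset (Fin n)) (i : Fin n),
      #(univ.filter fun b : Bool => i ∈ bif b then T else Tᶜ) = 1 := by
    intro T i
    rw [card_eq_one]
    by_cases hi : i ∈ T
    · exact ⟨true, by ext b; cases b <;> simp [hi]⟩
    · exact ⟨false, by ext b; cases b <;> simp [hi]⟩
  have h3 : ∀ T : Bool → Finset (Fin n), (∀ i, #{b | i ∈ T b} = 1) →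
      T = fun b => bif b then T true else (T true)ᶜ := by
    intro T h
    funext b
    cases b
    · ext i
      obtain ⟨b, hb⟩ := card_eq_one.1 (h i)
      have ht := Finset.ext_iff.1 hb true
      have hf := Finset.ext_iff.1 hb false
      simp only [mem_filter, mem_univ, true_and, mem_singleton] at ht hf
      cases b <;> simp_all
    · rfl
  simp only [h1]
  rw [← sum_filter, mul_sum]
  symm
  refine sum_bij' (fun T _ b => bif b then T else Tᶜ) (fun T _ => T true) ?_ ?_ ?_ ?_ ?_
  · intro T hT
    obtain ⟨hT, h⟩ := mem_filter.1 hT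
    rw [mem_filter, Fintype.mem_piFinset]
    refine ⟨Bool.forall_bool.2 ⟨?_, ?_⟩, h2 T⟩
    · exact mem_filter.2 ⟨compl_mem_invSets hT, h.2⟩
    · exact mem_filter.2 ⟨hT, h.1⟩
  · intro T hT
    rw [mem_filter, Fintype.mem_piFinset] at hT
    obtain ⟨hT, h⟩ := hT
    rw [h3 T h] at hT
    have ht := mem_filter.1 (hT true)
    exact mem_filter.2 ⟨ht.1, ht.2, (mem_filter.1 (hT false)).2⟩
  · intro T _; rfl
  · intro T hT
    exact (h3 T (mem_filter.1 hT).2).symm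
  · intro T hT
    have hT := (mem_filter.1 hT).1
    simp only [Fintype.prod_bool, cond_true, cond_false, sg_mul_sg_compl hT]
    rw [prod_ite]
    congr 2
    · exact prod_congr (by ext; simp) fun _ _ => rfl
    · exact prod_congr (by ext; simp) fun _ _ => rfl

end Coefficient

section SymbolCharacter
variable {n : ℕ}

theorem map_hp {A B : Type*} [CommRing A] [CommRing B] (φ : A →+* B) (p : Perm (Fin n))
    (v : Fin n → A) (k : ℤ) : φ (hp p v k) = hp p (fun i => φ (v i)) k := by
  simp [hp]

theorem map_ep {A B : Type*} [CommRing A] [CommRing B] (φ : A →+* B) (p : Perm (Fin n))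
    (v : Fin n → A) (k : ℕ) : φ (ep p v k) = ep p (fun i => φ (v i)) k := by
  simp [ep]

theorem det_eq_sum_prod {A : Type*} [CommRing A] {r : ℕ} (M : Matrix (Fin r) (Fin r) A) :
    M.det = ∑ σ : Perm (Fin r), ((Perm.sign σ : ℤ) : A) * ∏ i, M i (σ i) := by
  rw [← Matrix.det_transpose, Matrix.det_apply']
  rfl

open MvPolynomial

theorem coeff_det_mul_det (p : Perm (Fin n)) (c : ℕ) (w : Bool → Fin n → ℂ) :
    coeff (Finsupp.equivFunOnFinite.symm fun _ => 1)
      ((Matrix.of fun i j : Fin (c + 1) =>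
        hp p (fun x => (C (w false x) * X x : MvPolynomial (Fin n) ℂ))
          ((if (i : ℕ) < c then 1 else 0) - (i : ℕ) + (j : ℕ) : ℤ)).det *
      (Matrix.of fun i j : Fin c =>
        hp p (fun x => (C (w true x) * X x : MvPolynomial (Fin n) ℂ))
          (1 - (i : ℕ) + (j : ℕ) : ℤ)).det) =
    coeff (Finsupp.equivFunOnFinite.symm fun _ => 1)
      (∏ b : Bool, ep p (fun x => (C (w b x) * X x : MvPolynomial (Fin n) ℂ)) c) := by
  refine coeff_eq_of_sub_mem (Ideal.Quotient.eq.1 ?_)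
  set I := Ideal.span (Set.range fun i : Fin n => (X i * X i : MvPolynomial (Fin n) ℂ)) with hI
  have hv : ∀ b x, Ideal.Quotient.mk I (C (w b x) * X x) * Ideal.Quotient.mk I (C (w b x) * X x) =
      0 := by
    intro b x
    rw [← map_mul, mul_mul_mul_comm, Ideal.Quotient.eq_zero_iff_mem]
    exact I.mul_mem_left _ (Ideal.subset_span ⟨x, rfl⟩)
  rw [Fintype.prod_bool, map_mul, map_mul, mul_comm, map_ep, map_ep, ← det_hp p (hv true) c,
    ← det_hp_zero_row p (hv false) c, RingHom.map_det, RingHom.map_det]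
  congr 2 <;>
  · ext i j
    simp [map_hp]

theorem indPiece_eq_coeff {r s : ℕ} (a : Fin r → ℤ) (d : Fin s → ℤ) (t : Fin n → ℤˣ)
    (p : Perm (Fin n)) (hw : mk t p ∈ BWn n) (w : Bool → Fin n → ℂ)
    (hw' : w = fun b i => bif b then ((t i : ℤ) : ℂ) else 1) :
    indPiece n r s a d ⟨mk t p, hw⟩ = coeff (Finsupp.equivFunOnFinite.symm fun _ => 1)
      ((∏ i, hp p (fun x => (C (w false x) * X x : MvPolynomial (Fin n) ℂ)) (a i)) *
        ∏ j, hp p (fun x => (C (w true x) * X x : MvPolynomial (Fin n) ℂ)) (d j)) := by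
  have := prod_hp (p := p) (fun (b : Fin r ⊕ Fin s) => w b.isRight) (Sum.elim a d)
  rw [Fintype.prod_sum_type] at this
  simp only [Sum.isRight_inl, Sum.isRight_inr, Sum.elim_inl, Sum.elim_inr, Sum.forall] at this
  rw [this, indPiece_mk]
  refine sum_congr rfl fun g _ => ?_
  rw [lam_apply]
  refine prod_congr rfl fun i _ => ?_
  rw [hw']
  rcases (g i) <;> simp

theorem chiBSymbol_mk {c : ℕ} (hn : n = 2 * c) (t : Fin n → ℤˣ) (p : Perm (Fin n))
    (hw : mk t p ∈ BWn n) :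
    chiBSymbol n c (fun t => if (t : ℕ) = 0 then 0 else (t : ℕ) + 1)
        (fun t => (t : ℕ) + 1) ⟨mk t p, hw⟩ = chiF c t p := by
  set w : Bool → Fin n → ℂ := fun b i => bif b then ((t i : ℤ) : ℂ) else 1 with hw'
  have h1 : ∀ i j : Fin (c + 1), (((if c - (i : ℕ) = 0 then 0 else c - (i : ℕ) + 1 : ℕ) : ℤ) -
      ((c - (i : ℕ) : ℕ) : ℤ)) - (i : ℕ) + (j : ℕ) =
      (if (i : ℕ) < c then 1 else 0) - (i : ℕ) + (j : ℕ) := by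
    intro i j
    split_ifs <;> omega
  have h2 : ∀ i j : Fin c, (((c - 1 - (i : ℕ) + 1 : ℕ) : ℤ) -
      ((c - 1 - (i : ℕ) : ℕ) : ℤ)) - (i : ℕ) + (j : ℕ) = 1 - (i : ℕ) + (j : ℕ) := by
    intro i j
    push_cast
    ring
  rw [chiBSymbol, chiB, finsum_eq_sum_of_fintype]
  simp only [finsum_eq_sum_of_fintype, indPiece_eq_coeff _ _ t p hw w hw', h1, h2]
  have h3 := coeff_det_mul_det p c w
  rw [det_eq_sum_prod, det_eq_sum_prod, sum_mul_sum, coeff_sum] at h3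
  simp only [coeff_sum, Matrix.of_apply] at h3
  have h4 : ∀ (a b : ℤ) (P Q : MvPolynomial (Fin n) ℂ) (m : Fin n →₀ ℕ),
      coeff m ((a : MvPolynomial (Fin n) ℂ) * P * ((b : MvPolynomial (Fin n) ℂ) * Q)) =
      ((a * b : ℤ) : ℂ) * coeff m (P * Q) := by
    intro a b P Q m
    rw [mul_mul_mul_comm, ← Int.cast_mul, ← map_intCast (C : ℂ →+* MvPolynomial (Fin n) ℂ),
      coeff_C_mul]
  simp only [h4] at h3
  rw [h3, prod_ep w fun _ => c, chiF]
  congr 1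
  refine sum_congr ?_ fun T _ => ?_
  · ext T
    rw [mem_filter, mem_filter, mem_powersetCard_univ, mem_invSets_iff_ind, card_compl,
      Fintype.card_fin, and_comm]
    refine and_congr_left fun _ => ?_
    omega
  · rw [lam_apply]
    refine prod_congr rfl fun i _ => ?_
    by_cases hi : i ∈ T <;> simp [hw', ind, hi]

end SymbolCharacter

section MinimalDegree
variable {n : ℕ}

theorem sum_range_add_card_sdiff_le (s : Finset ℕ) :
    ∑ i ∈ range #s, i + #(s \ range #s) ≤ ∑ i ∈ s, i := by
  have hcard : #(s \ range #s) = #(range #s \ s) := by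
    have h1 := card_sdiff_add_card_inter s (range #s)
    have h2 := card_sdiff_add_card_inter (range #s) s
    rw [inter_comm, card_range] at h2
    omega
  have h1 : ∑ i ∈ s \ range #s, #s ≤ ∑ i ∈ s \ range #s, i :=
    sum_le_sum fun i hi => by simpa using (mem_sdiff.1 hi).2
  have h2 : ∑ i ∈ range #s \ s, (i + 1) ≤ ∑ i ∈ range #s \ s, #s :=
    sum_le_sum fun i hi => by simpa using (mem_sdiff.1 hi).1
  rw [sum_add_distrib] at h2
  have h3 := sum_inter_add_sum_sdiff s (range #s) fun i => i
  have h4 := sum_inter_add_sum_sdiff (range #s) s fun i => i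
  rw [inter_comm] at h4
  simp only [sum_const, smul_eq_mul, mul_one] at h1 h2
  rw [← hcard] at h2
  omega

theorem sum_eq_and_lt_of_injective {m : Fin n → ℕ} (hm : Function.Injective m)
    (h : ∑ i, m i ≤ ∑ i ∈ range n, i) : ∑ i, m i = ∑ i ∈ range n, i ∧ ∀ i, m i < n := by
  have hc : #(univ.map ⟨m, hm⟩) = n := by simp
  have h1 := sum_range_add_card_sdiff_le (univ.map ⟨m, hm⟩)
  rw [hc, sum_map] at h1
  simp only [Function.Embedding.coeFn_mk] at h1
  refine ⟨by omega, fun i => ?_⟩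
  have h2 : #((univ.map ⟨m, hm⟩) \ range n) = 0 := by omega
  rw [card_eq_zero, sdiff_eq_empty_iff_subset] at h2
  exact mem_range.1 (h2 (mem_map_of_mem ⟨m, hm⟩ (mem_univ i)))

theorem sum_eq_of_injective_of_lt {m : Fin n → ℕ} (hm : Function.Injective m)
    (h : ∀ i, m i < n) : ∑ i, m i = ∑ i ∈ range n, i := by
  have h1 : univ.map ⟨m, hm⟩ = range n := by
    refine eq_of_subset_of_card_le (fun k hk => ?_) (by simp)
    obtain ⟨i, -, rfl⟩ := mem_map.1 hk
    exact mem_range.2 (h i)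
  rw [← h1, sum_map]
  rfl

theorem exists_perm_of_injective {m m' : Fin n → ℕ} (hm : Function.Injective m)
    (hm' : Function.Injective m') (h : ∀ i, m i < n) (h' : ∀ i, m' i < n) :
    ∃ p : Perm (Fin n), m ∘ p = m' := by
  have e : ∀ {k : Fin n → ℕ} (_ : Function.Injective k) (hk : ∀ i, k i < n),
      Function.Bijective fun i => (⟨k i, hk i⟩ : Fin n) := fun hk' hk =>
    Finite.injective_iff_bijective.1 fun i j hij => hk' (Fin.ext_iff.1 hij)
  refine ⟨(Equiv.ofBijective _ (e hm' h')).trans (Equiv.ofBijective _ (e hm h)).symm,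
    funext fun i => ?_⟩
  have := (Equiv.ofBijective _ (e hm h)).apply_symm_apply (Equiv.ofBijective _ (e hm' h') i)
  exact Fin.ext_iff.1 this

theorem card_eq_card_stab {f m : Fin n → ℕ} (hm : Function.Injective m)
    {A : Finset (Fin n → ℕ)} (hA : ∀ k, k ∈ A ↔ ∃ p : Perm (Fin n), f ∘ p = f ∧ m ∘ p = k) :
    #A = #(stab f) := by
  symm
  refine card_bij (fun p _ => m ∘ p) (fun p hp => (hA _).2 ⟨p, mem_stab.1 hp, rfl⟩) ?_ ?_
  · intro p _ q _ h
    exact Equiv.ext fun i => hm (congrFun h i)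
  · intro k hk
    obtain ⟨p, hp, h⟩ := (hA k).1 hk
    exact ⟨p, mem_stab.2 hp, h⟩

/-- The exponents `1, 3, …, 2c - 1, 0, 2, …` of a monomial of minimal degree. -/
def minExp (c : ℕ) (i : Fin n) : ℕ := if (i : ℕ) < c then 2 * i + 1 else 2 * (i - c)

theorem minExp_injective (c : ℕ) : Function.Injective (minExp c : Fin n → ℕ) := by
  intro i j h
  simp only [minExp] at h
  ext
  split_ifs at h <;> omega

theorem minExp_lt {c : ℕ} (hn : n = 2 * c) (i : Fin n) : minExp c i < n := by
  have := i.2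
  simp only [minExp]
  split_ifs <;> omega

theorem odd_minExp {c : ℕ} (i : Fin n) : Odd (minExp c i) ↔ (i : ℕ) < c := by
  simp only [minExp]
  split_ifs with h <;> simp [h]

theorem card_filter_lt {c : ℕ} (hn : n = 2 * c) : #{i : Fin n | (i : ℕ) < c} = c := by
  rw [Fin.card_filter_val_lt]
  omega

theorem lam_one_add_of_odd {c : ℕ} {m : Fin n → ℕ} (hm : ∀ i, Odd (m i) ↔ (i : ℕ) < c)
    {s : Fin n → ℤˣ} (hs : s ∈ evenSigns n c) : lam (1 + m) s = 1 := by
  rw [mem_evenSigns] at hs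
  have h1 : lam (1 + m) s = ((∏ i with c ≤ (i : Fin n).val, s i : ℤˣ) : ℤ) := by
    rw [lam_apply, Units.coe_prod, Int.cast_prod, prod_filter]
    refine prod_congr rfl fun i _ => ?_
    have := hm i
    rcases Int.units_eq_one_or (s i) with h | h
    · simp [h]
    · by_cases hi : (i : ℕ) < c
      · simp [h, not_le.2 hi, Odd.neg_one_pow, pow_add, this.2 hi]
      · have he := Nat.not_odd_iff_even.1 (mt this.1 hi)
        simp [h, not_lt.1 hi, pow_add, he]
  rw [h1, hs]
  simp

theorem odd_of_lam {c : ℕ} {m : Fin n → ℕ} (h : ∀ s ∈ evenSigns n c, lam (1 + m) s = 1)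
    {i : Fin n} (hi : (i : ℕ) < c) : Odd (m i) := by
  have := even_of_lam_mulSingle (h _ (mulSingle_mem_evenSigns hi))
  simp only [Pi.add_apply, Pi.one_apply, add_comm 1] at this
  exact Nat.not_even_iff_odd.1 (Nat.even_add_one.1 this)

theorem odd_iff_odd_of_lam {c : ℕ} {m : Fin n → ℕ}
    (h : ∀ s ∈ evenSigns n c, lam (1 + m) s = 1) {i j : Fin n} (hi : c ≤ (i : ℕ))
    (hj : c ≤ (j : ℕ)) : Odd (m i) ↔ Odd (m j) := by
  have := h _ (mulSingle_mul_mem_evenSigns hi hj)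
  rw [map_mul, lam_mulSingle, lam_mulSingle] at this
  simp only [Pi.add_apply, Pi.one_apply, pow_add, pow_one] at this
  rcases Nat.even_or_odd (m i) with hi | hi <;> rcases Nat.even_or_odd (m j) with hj | hj <;>
    simp only [hi, hj, Even.neg_one_pow, Odd.neg_one_pow] at this <;> norm_num at this
  · simp [← Nat.not_even_iff_odd, hi, hj]
  · simp [hi, hj]

/-- The sign character of `W_c × W'_{n-c}` occurs in minimal degree only through families of
distinct exponents that are odd exactly on the first block. -/
theorem injective_and_odd_of_lam {c : ℕ} {f m : Fin n → ℕ}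
    (hf : ∀ i j, f i = f j ↔ (i.val < c ↔ j.val < c))
    (hinj : ∀ i j, f i = f j → m i = m j → i = j)
    (hlam : ∀ s ∈ evenSigns n c, lam (1 + m) s = 1) (hsum : ∑ i, m i ≤ ∑ i ∈ range n, i) :
    Function.Injective m ∧ ∀ i, Odd (m i) ↔ (i : ℕ) < c := by
  have hodd : ∀ i, Odd (m i) ↔ (i : ℕ) < c := by
    by_contra! hne
    obtain ⟨i, hi⟩ := hne
    have hi' : c ≤ (i : ℕ) ∧ Odd (m i) := by
      rcases hi with h | h
      · exact ⟨h.2, h.1⟩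
      · exact absurd (odd_of_lam hlam h.2) h.1
    have hall : ∀ j, Odd (m j) := fun j => by
      by_cases hj : (j : ℕ) < c
      · exact odd_of_lam hlam hj
      · exact (odd_iff_odd_of_lam hlam hi'.1 (not_lt.1 hj)).1 hi'.2
    have hm' : Function.Injective fun j : Fin n => if (j : ℕ) < c then m j else m j - 1 := by
      intro j k hjk
      have hj := hall j
      have hk := hall k
      rw [Nat.odd_iff] at hj hk
      refine hinj j k ((hf j k).2 ?_) ?_ <;> dsimp only at hjk <;> split_ifs at hjk <;> omega
    have hlt : ∑ j : Fin n, (if (j : ℕ) < c then m j else m j - 1) < ∑ j, m j := by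
      refine sum_lt_sum (fun j _ => by split_ifs <;> omega) ⟨i, mem_univ i, ?_⟩
      rw [if_neg (not_lt.2 hi'.1)]
      have := hi'.2.pos
      omega
    have := sum_eq_and_lt_of_injective hm' (hlt.le.trans hsum)
    omega
  refine ⟨fun i j hij => hinj i j ((hf i j).2 ?_) hij, hodd⟩
  rw [← hodd, ← hodd, hij]

end MinimalDegree

section JInduction
variable {n : ℕ}

theorem isSemi_BWn (n : ℕ) : IsSemi (BWn n) ⊤ fun _ => 0 := isSemi_B _

theorem IsSemi.le_BWn {H : Subgroup (PG n)} {S : Subgroup (Fin n → ℤˣ)} {f : Fin n → ℕ}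
    (h : IsSemi H S f) : H ≤ BWn n := by
  intro w hw
  obtain ⟨s, -, p, -, rfl⟩ := (h w).1 hw
  exact (isSemi_BWn n).mem.2 ⟨trivial, rfl⟩

theorem isBAt_chiF {c : ℕ} (hn : n = 2 * c) (χ : BWn n → ℂ)
    (hχ : ∀ s p (hw : mk s p ∈ BWn n), χ ⟨mk s p, hw⟩ = chiF c s p) :
    IsBAt (resChar (BWn n) reflChar) χ (∑ i ∈ range n, i) := by
  classical
  have hinj : ∀ m : Fin n → ℕ, (∀ i j : Fin n, (0 : ℕ) = 0 → m i = m j → i = j) →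
      Function.Injective m := fun m h i j hij => h i j rfl hij
  constructor
  · rw [bMult_chiF (isSemi_BWn n) c _ χ hχ]
    refine mul_ne_zero (inv_ne_zero (card_perm_ne_zero _)) (Nat.cast_ne_zero.2 ?_)
    refine (card_pos.2 ⟨minExp c, mem_filter.2 ⟨?_, fun i j _ h => minExp_injective c h, ?_⟩⟩).ne'
    · rw [mem_piAntidiag]
      exact ⟨sum_eq_of_injective_of_lt (minExp_injective c) (minExp_lt hn), by simp⟩
    · simp only [oddSet, odd_minExp]
      exact card_filter_lt hn
  · intro d hd
    rw [bMult_chiF (isSemi_BWn n) c _ χ hχ, filter_eq_empty_iff.2, card_empty, Nat.cast_zero,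
      mul_zero]
    rintro m hm ⟨h, -⟩
    rw [mem_piAntidiag] at hm
    have := sum_eq_and_lt_of_injective (hinj m h) (hm.1.le.trans hd.le)
    exact absurd (this.1.symm.trans hm.1) hd.ne'

/-- The criterion for `χ_c` to be obtained by `j`-induction of the sign character. -/
theorem isJInd_of_exponents {H : Subgroup (PG n)} {S : Subgroup (Fin n → ℤˣ)} {f : Fin n → ℕ}
    (h : IsSemi H S f) {c : ℕ} (hn : n = 2 * c) (χ : BWn n → ℂ)
    (hχ : ∀ s p (hw : mk s p ∈ BWn n), χ ⟨mk s p, hw⟩ = chiF c s p)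
    (hS : ∀ m : Fin n → ℕ, (∀ i, Odd (m i) ↔ (i : ℕ) < c) → ∀ s ∈ S, lam (1 + m) s = 1)
    (hmin : ∀ m : Fin n → ℕ, (∀ i j, f i = f j → m i = m j → i = j) →
      (∀ s ∈ S, lam (1 + m) s = 1) → ∑ i, m i ≤ ∑ i ∈ range n, i → Function.Injective m)
    (hperm : ∀ p : Perm (Fin n), f ∘ p = f ↔ ∀ s ∈ S, lam (1 + minExp c ∘ p) s = 1) :
    IsJInd reflChar H (BWn n) (resChar H sgnChar) χ := by
  classical
  have hchar : IsChar χ := isChar_chiF (isSemi_BWn n) c χ hχ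
  have hone : bMult (resChar H reflChar) (resChar H sgnChar) (∑ i ∈ range n, i) = 1 := by
    rw [bMult_sgn h, card_eq_card_stab (f := f) (minExp_injective c),
      inv_mul_cancel₀ (card_perm_ne_zero f)]
    intro m
    rw [mem_filter, mem_piAntidiag]
    constructor
    · rintro ⟨⟨hsum, -⟩, h1, h2⟩
      have hm := hmin m h1 h2 hsum.le
      obtain ⟨p, rfl⟩ := exists_perm_of_injective (minExp_injective c) hm (minExp_lt hn)
        (sum_eq_and_lt_of_injective hm hsum.le).2
      exact ⟨p, (hperm p).2 h2, rfl⟩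
    · rintro ⟨p, hp, rfl⟩
      have hm := (minExp_injective c).comp p.injective
      exact ⟨⟨sum_eq_of_injective_of_lt hm fun i => minExp_lt hn _, by simp⟩,
        fun i j _ hij => hm hij, (hperm p).1 hp⟩
  refine ⟨⟨hchar, cinner_chiF_self (fun _ _ => rfl) (isSemi_BWn n) (by omega) χ hχ⟩, ?_, _,
    ⟨by rw [hone]; exact one_ne_zero, fun d hd => ?_⟩, hone, isBAt_chiF hn χ hχ⟩
  · rw [cinner_indChar h.le_BWn χ hchar.conj]
    refine cinner_chiF_sgn_ne_zero h {i | (i : ℕ) < c} (card_filter_lt hn) ?_ _ fun s p hw => ?_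
    · rw [add_comm]
      refine hS _ fun i => ?_
      by_cases hi : (i : ℕ) < c <;> simp [ind, hi]
    · rw [resSub, dif_pos (h.le_BWn hw)]
      exact hχ s p _
  · rw [bMult_sgn h, filter_eq_empty_iff.2, card_empty, Nat.cast_zero, mul_zero]
    rintro m hm ⟨h1, h2⟩
    rw [mem_piAntidiag] at hm
    have hle := hm.1.le.trans hd.le
    have := sum_eq_and_lt_of_injective (hmin m h1 h2 hle) hle
    exact absurd (this.1.symm.trans hm.1) hd.ne'

theorem blockOf_two_eq_iff {c : ℕ} (hn : n = 2 * c) (i j : Fin n) :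
    blockOf 2 (fun _ => c) i = blockOf 2 (fun _ => c) j ↔ ((i : ℕ) < c ↔ (j : ℕ) < c) := by
  have hc : ∑ _b ∈ range 2, c = n := by simp [hn]
  have h0 : ∀ k : Fin n, blockOf 2 (fun _ => c) k = 0 ↔ (k : ℕ) < c := fun k => by
    rw [← Nat.le_zero, blockOf_le_iff _ two_pos]
    simp
  rw [← h0, ← h0]
  have hi := blockOf_lt (fun _ => c) hc i
  have hj := blockOf_lt (fun _ => c) hc j
  omega

end JInduction

/-- 3.2(a): in the hyperoctahedral group `W_n` with `n = 2c`, the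
`j`-induction of the sign representation from the reflection subgroup `W_c × W'_c`
equals the `j`-induction of the sign representation from the reflection subgroup
`S_n`, and both equal the irreducible representation with symbol
`[(0 < 2 < 3 < … < c+1), (1 < 2 < … < c)]`. -/
theorem stmt10 (c n : ℕ) (hn : n = 2 * c) :
    IsJInd (reflChar (n := n))
      (blkSub n (fun i => blockOf 2 (fun _ => c) (i : ℕ))
        (fun i => if (i : ℕ) < c then BTy.B else BTy.D))
      (BWn n) (resChar _ sgnChar)
      (chiBSymbol n c (fun t => if (t : ℕ) = 0 then 0 else (t : ℕ) + 1)
        (fun t => (t : ℕ) + 1)) ∧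
    IsJInd (reflChar (n := n))
      (blkSub n (fun _ => 0) (fun _ => BTy.S))
      (BWn n) (resChar _ sgnChar)
      (chiBSymbol n c (fun t => if (t : ℕ) = 0 then 0 else (t : ℕ) + 1)
        (fun t => (t : ℕ) + 1)) := by
  have hf := blockOf_two_eq_iff hn
  constructor
  · refine isJInd_of_exponents (isSemi_BD hf) hn _ (chiBSymbol_mk hn)
      (fun m hm s hs => lam_one_add_of_odd hm hs)
      (fun m h1 h2 h3 => (injective_and_odd_of_lam hf h1 h2 h3).1) fun p => ?_
    constructor
    · intro hp s hs
      refine lam_one_add_of_odd (fun i => ?_) hs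
      rw [Function.comp_apply, odd_minExp]
      exact (hf (p i) i).1 (congrFun hp i)
    · intro h
      have hm := (minExp_injective c).comp p.injective
      have hodd := (injective_and_odd_of_lam hf (fun i j _ hij => hm hij) h
        (sum_eq_of_injective_of_lt hm fun i => minExp_lt hn _).le).2
      refine funext fun i => (hf (p i) i).2 ?_
      rw [← hodd i, Function.comp_apply, odd_minExp]
  · refine isJInd_of_exponents (isSemi_S _) hn _ (chiBSymbol_mk hn) ?_
      (fun m h1 _ _ i j hij => h1 i j rfl hij) fun p => ?_
    · intro m _ s hs
      rw [Subgroup.mem_bot.1 hs, map_one]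
    · refine iff_of_true rfl fun s hs => ?_
      rw [Subgroup.mem_bot.1 hs, map_one]

end
end CS
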